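/- arXiv:1610.09162 — 4 statements merged into one kernel-verified Lean document; each statement's English description precedes it below -/
import Mathlib

section
/- Let F/L/K be a tower of extensions of analytic fields of residue characteristic zero (char(tilde K) = 0). If either topdeg(F/K) is finite, or both topdeg(F/L) and topdeg(L/K) are finite, then topdeg(F/K) = topdeg(F/L) + topdeg(L/K). -/
open Metric

set_option linter.unusedSectionVars false

/-!
Ambient setting: every extension of analytic (complete, non-archimedean, real-valued)
fields `L/K` embeds isometrically into an algebraically closed, complete,
non-archimedean normed field `Ω` (e.g. the completed algebraic closure of `L`).
We therefore formalize analytic fields as closed subfields of such an ambient field `Ω`.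
-/

variable {Ω : Type*} [NormedField Ω] [CompleteSpace Ω] [IsUltrametricDist Ω] [IsAlgClosed Ω]

/-- The completion `hat{K(S)}` of the subfield generated by `K` and `S`, realized inside
the ambient analytic field `Ω` as the topological closure of the generated subfield. -/
noncomputable def hatGen (K : Subfield Ω) (S : Set Ω) : Subfield Ω :=
  (Subfield.closure ((K : Set Ω) ∪ S)).topologicalClosure

/-- `t` is topologically algebraic ("topgebraic") over `K`: it lies in the closure of the
set of elements algebraic over `K`, i.e. in the completed algebraic closure `hat{K^a}`. -/
def IsTopgebraicElem (K : Subfield Ω) (t : Ω) : Prop :=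
  t ∈ closure {x : Ω | IsAlgebraic K x}

/-- `t` is topologically transcendental over `K`. -/
def TopTranscendental (K : Subfield Ω) (t : Ω) : Prop := ¬ IsTopgebraicElem K t

/-- `S` is topgebraically independent over `K`: every `x ∈ S` is topologically
transcendental over `hat{K(S \ {x})}`. -/
def TopgebraicIndep (K : Subfield Ω) (S : Set Ω) : Prop :=
  ∀ x ∈ S, TopTranscendental (hatGen K (S \ {x})) x

/-- `S` topgebraically generates `L` over `K`: the extension `L / hat{K(S)}` is
topgebraic, i.e. `L` is contained in the completed algebraic closure of `hat{K(S)}`. -/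
def TopgebraicallyGenerates (K L : Subfield Ω) (S : Set Ω) : Prop :=
  (L : Set Ω) ⊆ closure {x : Ω | IsAlgebraic (hatGen K S) x}

/-- The topological transcendence degree of `L/K`: the least cardinal bounding the
cardinality of every topgebraically independent subset of `L`. -/
noncomputable def topdeg (K L : Subfield Ω) : Cardinal :=
  ⨆ S : {S : Set Ω // S ⊆ (L : Set Ω) ∧ TopgebraicIndep K S}, Cardinal.mk S.1

/-- The topgebraic generating degree of `L/K`: the least cardinality of a
topgebraically generating subset of `L` over `K`. -/
noncomputable def Topdeg (K L : Subfield Ω) : Cardinal :=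
  ⨅ S : {S : Set Ω // S ⊆ (L : Set Ω) ∧ TopgebraicallyGenerates K L S}, Cardinal.mk S.1

/-- The `K`-radius of `t`: the distance from `t` to the algebraic closure of `K`. -/
noncomputable def rad (K : Subfield Ω) (t : Ω) : ℝ :=
  Metric.infDist t {x : Ω | IsAlgebraic K x}

/-- The `K`-multiradius of an element `t` of `S`. -/
noncomputable def radS (K : Subfield Ω) (S : Set Ω) (t : Ω) : ℝ :=
  rad (hatGen K (S \ {t})) t

lemma mem_hatGen_of_mem {K : Subfield Ω} {S : Set Ω} {c : Ω} (hc : c ∈ K) : c ∈ hatGen K S :=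
  Subfield.le_topologicalClosure _ (Subfield.subset_closure (Or.inl hc))

lemma mem_hatGen_of_mem_set {K : Subfield Ω} {S : Set Ω} {t : Ω} (ht : t ∈ S) : t ∈ hatGen K S :=
  Subfield.le_topologicalClosure _ (Subfield.subset_closure (Or.inr ht))

/-- The residue field of (any analytic subfield of) `Ω` has characteristic zero:
every nonzero natural number is a unit of the ring of integers, i.e. has norm `1`. -/
def ResidueCharZero (Ω : Type*) [NormedField Ω] : Prop :=
  ∀ n : ℕ, n ≠ 0 → ‖(n : Ω)‖ = 1

section

open Polynomial Filter Topology

theorem exists_derivation_of_transcendental {F E : Type*} [Field F] [Field E] [Algebra F E]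
    [CharZero F] {t : E} (ht : Transcendental F t) :
    ∃ D : Derivation F E E, D t = 1 := by
  classical
  obtain ⟨s, hts, hs⟩ := exists_isTranscendenceBasis_superset (R := F) (s := {t})
    (by
      have := (algebraicIndependent_unique_type_iff (R := F)
        (x := ((↑) : ({t} : Set E) → E))).2 (by simpa using ht)
      exact this)
  let A := MvPolynomial s F
  let x : s → E := Subtype.val
  let : Algebra A E := (MvPolynomial.aeval x : A →ₐ[F] E).toRingHom.toAlgebra
  have hA : ∀ p : A, algebraMap A E p = MvPolynomial.aeval x p := fun _ => rfl
  have : IsScalarTower F A E := IsScalarTower.of_algebraMap_eq' (by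
    ext c; simp [hA, A])
  have hinj : Function.Injective (algebraMap A E) := hs.1
  have : FaithfulSMul A E := (faithfulSMul_iff_algebraMap_injective A E).2 hinj
  let Q := FractionRing A
  let : Algebra Q E := FractionRing.liftAlgebra A E
  have : IsScalarTower A Q E := FractionRing.isScalarTower_liftAlgebra A E
  have : Algebra.IsAlgebraic A E := by
    have := hs.isAlgebraic
    let e := hs.1.aevalEquiv
    exact Algebra.IsAlgebraic.of_ringHom_of_comp_eq e (AlgHom.id F E) e.surjective
      Function.injective_id (RingHom.ext fun p => hs.1.algebraMap_aevalEquiv p)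
  have : Algebra.IsAlgebraic Q E :=
    (IsFractionRing.comap_isAlgebraic_iff (A := A) (K := Q) (C := E)).1 inferInstance
  have : CharZero Q := inferInstance
  have : Algebra.FormallyEtale Q E := Algebra.FormallyEtale.of_isSeparable Q E
  have : Algebra.FormallyEtale A Q := Algebra.FormallyEtale.of_isLocalization (nonZeroDivisors A)
  have : Algebra.FormallyEtale A E := Algebra.FormallyEtale.comp A Q E
  let d : Derivation F A E :=
    MvPolynomial.mkDerivation F (fun i : s => if (i : E) = t then 1 else 0)
  let φ := d.liftKaehlerDifferential.liftBaseChange E ∘ₗ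
    (KaehlerDifferential.tensorKaehlerEquivOfFormallyEtale F A E).symm.toLinearMap
  refine ⟨φ.compDer (KaehlerDifferential.D F E), ?_⟩
  have htA : algebraMap A E (MvPolynomial.X ⟨t, hts rfl⟩) = t := by simp [hA, A, x]
  have := KaehlerDifferential.tensorKaehlerEquivOfFormallyEtale_symm_D_algebraMap F A E
    (MvPolynomial.X ⟨t, hts rfl⟩)
  rw [htA] at this
  simp [φ, this, d, A]

section
variable {Ω : Type*} [NormedField Ω]

theorem norm_le_one_of_isAlgebraic [IsUltrametricDist Ω] (N : Subfield Ω)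
    (hN : ∀ x : N, ‖x‖ ≤ 1) {w : Ω} (hw : IsAlgebraic N w) : ‖w‖ ≤ 1 := by
  by_contra! h
  have h0 := minpoly.aeval N w
  have hm := minpoly.monic hw.isIntegral
  rw [aeval_eq_sum_range, Finset.sum_range_succ, hm.coeff_natDegree, one_smul] at h0
  obtain ⟨i, hi, hle⟩ := IsUltrametricDist.exists_norm_finsetSum_le_of_nonempty
    (Finset.nonempty_range_iff.2 (minpoly.natDegree_pos hw.isIntegral).ne')
    fun i => (minpoly N w).coeff i • w ^ i
  rw [eq_neg_of_add_eq_zero_left h0, norm_neg, norm_pow, Algebra.smul_def, norm_mul,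
    norm_pow] at hle
  have h1 : ‖algebraMap N Ω ((minpoly N w).coeff i)‖ ≤ 1 := hN _
  have h2 := pow_lt_pow_right₀ h (Finset.mem_range.1 hi)
  nlinarith [pow_nonneg (norm_nonneg w) i]

theorem norm_coeff_minpoly_le_of_isClosed [CompleteSpace Ω] [IsUltrametricDist Ω] (N : Subfield Ω)
    (hN : IsClosed (N : Set Ω)) {z : Ω} (hz : IsAlgebraic N z) (i : ℕ)
    (hi : i < (minpoly N z).natDegree) :
    ‖((minpoly N z).coeff i : Ω)‖ ≤ ‖z‖ ^ ((minpoly N z).natDegree - i) := by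
  by_cases hnt : ∃ x : N, 1 < ‖x‖
  · let _ : NontriviallyNormedField N := { non_trivial := hnt }
    have : CompleteSpace N := hN.completeSpace_coe
    have : IsUltrametricDist N := ⟨fun x y z => dist_triangle_max (x : Ω) y z⟩
    let L := algebraicClosure N Ω
    let w : L := ⟨z, mem_algebraicClosure_iff.2 hz⟩
    have : Algebra.IsAlgebraic N L := inferInstance
    have hw : minpoly N w = minpoly N z :=
      (minpoly.algebraMap_eq (algebraMap L Ω).injective w).symm
    have key : ‖z‖ = spectralNorm N L w :=
      spectralNorm_unique_field_norm_ext
        (f := (NormedField.toAbsoluteValue Ω).comp (algebraMap L Ω).injective) (fun x => rfl) w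
    have h1 := le_ciSup (spectralValueTerms_bddAbove (minpoly N z)) i
    rw [spectralNorm, hw] at key
    change _ ≤ spectralValue _ at h1
    rw [← key, spectralValueTerms_of_lt_natDegree _ hi] at h1
    have hpos : (0 : ℝ) < (minpoly N z).natDegree - i := by
      have : (i : ℝ) < (minpoly N z).natDegree := by exact_mod_cast hi
      linarith
    rw [← Real.rpow_natCast, Nat.cast_sub hi.le]
    rw [one_div, Real.rpow_inv_le_iff_of_pos (norm_nonneg _) (norm_nonneg _) hpos] at h1
    exact h1
  · push Not at hnt
    rcases eq_or_ne z 0 with rfl | h0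
    · simp only [minpoly.zero, natDegree_X] at hi ⊢
      simp [Nat.lt_one_iff.1 hi]
    have h1 : ‖z⁻¹‖ ≤ 1 := norm_le_one_of_isAlgebraic N hnt hz.inv
    rw [norm_inv] at h1
    exact (hnt _).trans (one_le_pow₀ ((inv_le_one₀ (norm_pos_iff.2 h0)).1 h1))

theorem coeff_taylor_natDegree_sub_one {R : Type*} [CommRing R] {p : R[X]} (hp : p.Monic)
    (h : p.natDegree ≠ 0) (r : R) :
    (taylor r p).coeff (p.natDegree - 1) = p.coeff (p.natDegree - 1) + p.natDegree * r := by
  obtain ⟨n, hn⟩ := Nat.exists_eq_succ_of_ne_zero h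
  have hd : (hasseDeriv n p).natDegree < 2 :=
    (natDegree_hasseDeriv_le p n).trans_lt (by omega)
  have hl : p.coeff (n + 1) = 1 := by
    rw [← Nat.succ_eq_add_one, ← hn]; exact hp.coeff_natDegree
  rw [taylor_coeff, hn, Nat.succ_sub_one, eval_eq_sum_range' hd]
  simp [Finset.sum_range_succ, hasseDeriv_coeff, add_comm 1 n, hl]

variable (D : Derivation ℤ Ω Ω)

theorem Derivation.apply_eval_eq_sum (p : Polynomial Ω) (x : Ω) :
    D (p.eval x) = ∑ i ∈ Finset.range (p.natDegree + 1), D (p.coeff i) * x ^ i +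
      p.derivative.eval x * D x := by
  rw [eval_eq_sum_range, derivative_eval, sum_over_range _ (by simp), map_sum, Finset.sum_mul,
    ← Finset.sum_add_distrib]
  refine Finset.sum_congr rfl fun i _ => ?_
  simp only [Derivation.leibniz, Derivation.leibniz_pow, smul_eq_mul, nsmul_eq_mul]
  ring

variable {D} {C : ℝ}

theorem norm_deriv_mul_le {x y : Ω} [IsUltrametricDist Ω]
    (hx : ‖D x‖ ≤ C * ‖x‖) (hy : ‖D y‖ ≤ C * ‖y‖) : ‖D (x * y)‖ ≤ C * ‖x * y‖ := by
  rw [Derivation.leibniz, smul_eq_mul, smul_eq_mul]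
  refine (IsUltrametricDist.norm_add_le_max _ _).trans (max_le ?_ ?_) <;> rw [norm_mul, norm_mul]
  · nlinarith [norm_nonneg x]
  · nlinarith [norm_nonneg y]

theorem norm_deriv_inv_le {x : Ω} (hx : ‖D x‖ ≤ C * ‖x‖) : ‖D x⁻¹‖ ≤ C * ‖x⁻¹‖ := by
  rcases eq_or_ne x 0 with rfl | h0
  · simp
  have h0' := norm_pos_iff.2 h0
  rw [Derivation.leibniz_inv, smul_eq_mul, norm_mul, norm_neg, norm_pow, norm_inv]
  calc ‖x‖⁻¹ ^ 2 * ‖D x‖ ≤ ‖x‖⁻¹ ^ 2 * (C * ‖x‖) := by gcongr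
    _ = C * ‖x‖⁻¹ := by field_simp

theorem norm_deriv_multiset_prod_le [IsUltrametricDist Ω] (hC : 0 ≤ C) (s : Multiset Ω)
    (hs : ∀ x ∈ s, ‖D x‖ ≤ C * ‖x‖) : ‖D s.prod‖ ≤ C * ‖s.prod‖ :=
  Multiset.prod_induction (fun x => ‖D x‖ ≤ C * ‖x‖) s (fun _ _ => norm_deriv_mul_le)
    (by simpa using hC) hs

theorem norm_deriv_aeval_le [IsUltrametricDist Ω] [IsAlgClosed Ω] (hC : 0 ≤ C) {M : Subfield Ω}
    (hM : ∀ z ∈ M, ‖D z‖ ≤ C * ‖z‖) {y : Ω} (hy : ∀ a ∈ M, ‖D (y - a)‖ ≤ C * ‖y - a‖) (f : M[X])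
    (hf : ∀ a ∈ f.aroots Ω, a ∈ M) : ‖D (aeval y f)‖ ≤ C * ‖aeval y f‖ := by
  rw [← eval_map_algebraMap, (IsAlgClosed.splits _).eval_eq_prod_roots, leadingCoeff_map]
  refine norm_deriv_mul_le (hM _ (SetLike.coe_mem _)) (norm_deriv_multiset_prod_le hC _ ?_)
  simp only [Multiset.mem_map]
  rintro _ ⟨a, ha, rfl⟩
  exact hy a (hf a ha)

theorem norm_deriv_le_of_mem_closure [CharZero Ω] {M : Subfield Ω}
    (hM : ∀ z ∈ M, ‖D z‖ ≤ C * ‖z‖) {y : Ω} (hy : IsAlgebraic M y)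
    (hyM : y ∈ closure (M : Set Ω)) : ‖D y‖ ≤ C * ‖y‖ := by
  have : (𝓝[(M : Set Ω)] y).NeBot := mem_closure_iff_nhdsWithin_neBot.1 hyM
  set p := (minpoly M y).map (algebraMap M Ω) with hp
  have hpM : ∀ b ∈ M, p.eval b ∈ M := fun b hb => by
    have : p.eval b = algebraMap M Ω ((minpoly M y).eval ⟨b, hb⟩) := by
      rw [hp, eval_map_algebraMap]
      exact aeval_algebraMap_apply_eq_algebraMap_eval (A := Ω) (⟨b, hb⟩ : M) _
    rw [this]
    exact SetLike.coe_mem _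
  have hpy : p.eval y = 0 := by rw [hp, eval_map_algebraMap, minpoly.aeval]
  have hp' : p.derivative.eval y ≠ 0 := by
    rw [hp, derivative_map, eval_map_algebraMap]
    exact (minpoly.irreducible hy.isIntegral).separable.aeval_derivative_ne_zero (minpoly.aeval _ _)
  let q : Ω → Ω := fun x => ∑ i ∈ Finset.range (p.natDegree + 1), D (p.coeff i) * x ^ i
  have hq : Continuous q := by fun_prop
  have h0 : Tendsto (fun b => D (p.eval b)) (𝓝[(M : Set Ω)] y) (𝓝 0) := by
    rw [tendsto_zero_iff_norm_tendsto_zero]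
    have hlim : Tendsto (fun b => C * ‖p.eval b‖) (𝓝[(M : Set Ω)] y) (𝓝 0) := by
      have : Continuous fun b => C * ‖p.eval b‖ := by fun_prop
      have := (this.tendsto y).mono_left (nhdsWithin_le_nhds (s := (M : Set Ω)))
      simpa [hpy] using this
    refine squeeze_zero' (.of_forall fun _ => norm_nonneg _) ?_ hlim
    filter_upwards [self_mem_nhdsWithin] with b hb using hM _ (hpM b hb)
  have h1 : Tendsto (fun b => (D (p.eval b) - q b) / p.derivative.eval b) (𝓝[(M : Set Ω)] y)
      (𝓝 (D y)) := by
    have hy' : D y = (0 - q y) / p.derivative.eval y := by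
      have := D.apply_eval_eq_sum p y
      rw [hpy, map_zero] at this
      rw [eq_div_iff hp']
      linear_combination -this
    rw [hy']
    exact (h0.sub ((hq.tendsto y).mono_left nhdsWithin_le_nhds)).div
      ((p.derivative.continuous.tendsto y).mono_left nhdsWithin_le_nhds) hp'
  have h2 : Tendsto (fun b => C * ‖b‖) (𝓝[(M : Set Ω)] y) (𝓝 (C * ‖y‖)) :=
    ((continuous_const.mul continuous_norm).tendsto y).mono_left nhdsWithin_le_nhds
  refine le_of_tendsto_of_tendsto h1.norm h2 ?_
  have hne : ∀ᶠ b in 𝓝[(M : Set Ω)] y, p.derivative.eval b ≠ 0 :=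
    ((p.derivative.continuous.tendsto y).mono_left nhdsWithin_le_nhds).eventually_ne hp'
  filter_upwards [self_mem_nhdsWithin, hne] with b hb hb'
  have : (D (p.eval b) - q b) / p.derivative.eval b = D b := by
    rw [div_eq_iff hb', D.apply_eval_eq_sum p b]
    ring
  rw [this]
  exact hM b hb

end

theorem IsAlgebraic.of_subfield_le {Ω : Type*} [Field Ω] {M N : Subfield Ω} (h : M ≤ N) {x : Ω}
    (hx : IsAlgebraic M x) : IsAlgebraic N x := by
  let _ : Algebra M N := (Subfield.inclusion h).toAlgebra
  have : IsScalarTower M N Ω := .of_algebraMap_eq fun _ => rfl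
  exact hx.tower_top N

theorem IsAlgebraic.trans_subfield {Ω : Type*} [Field Ω] {M N : Subfield Ω} (h : M ≤ N)
    (hN : ∀ z ∈ N, IsAlgebraic M z) {x : Ω} (hx : IsAlgebraic N x) : IsAlgebraic M x := by
  let _ : Algebra M N := (Subfield.inclusion h).toAlgebra
  have : IsScalarTower M N Ω := .of_algebraMap_eq fun _ => rfl
  have : Algebra.IsAlgebraic M N := ⟨fun z =>
    (isAlgebraic_algebraMap_iff (algebraMap N Ω).injective).1 (hN z z.2)⟩
  exact hx.restrictScalars M

theorem minpoly_eq_map_of_forall_coeff_mem {M N E : Type*} [Field M] [Field N] [Field E]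
    [Algebra M N] [Algebra N E] [Algebra M E] [IsScalarTower M N E] {z : E} (hz : IsAlgebraic M z)
    (h : ∀ j, (minpoly N z).coeff j ∈ Set.range (algebraMap M N)) :
    minpoly N z = (minpoly M z).map (algebraMap M N) := by
  have hm := minpoly.monic (hz.tower_top N).isIntegral
  obtain ⟨q, hq, -, hqm⟩ := lifts_and_natDegree_eq_and_monic
    ((lifts_iff_coeff_lifts _).2 h) hm
  have hdvd : minpoly M z ∣ q := minpoly.dvd _ _ <| by
    rw [← aeval_map_algebraMap N, hq, minpoly.aeval]
  refine (Polynomial.eq_of_monic_of_dvd_of_natDegree_le hm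
    ((minpoly.monic hz.isIntegral).map _) (minpoly.dvd_map_of_isScalarTower M N z) ?_).symm
  rw [← hq, natDegree_map, natDegree_map]
  exact natDegree_le_of_dvd hdvd hqm.ne_zero

section
variable {Ω : Type*} [NormedField Ω]

theorem norm_coeff_minpoly_le [CompleteSpace Ω] [IsUltrametricDist Ω] (M : Subfield Ω)
    (hM : ∀ w ∈ closure (M : Set Ω), IsAlgebraic M w → w ∈ M) {z : Ω} (hz : IsAlgebraic M z) (i : ℕ)
    (hi : i < (minpoly M z).natDegree) :
    ‖((minpoly M z).coeff i : Ω)‖ ≤ ‖z‖ ^ ((minpoly M z).natDegree - i) := by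
  let N := M.topologicalClosure
  have hMN : M ≤ N := M.le_topologicalClosure
  let _ : Algebra M N := (Subfield.inclusion hMN).toAlgebra
  have : IsScalarTower M N Ω := .of_algebraMap_eq fun _ => rfl
  have hzN : IsAlgebraic N z := hz.of_subfield_le hMN
  have hmem (j : ℕ) : ((minpoly N z).coeff j : Ω) ∈ M := by
    refine hM _ (SetLike.coe_mem ((minpoly N z).coeff j)) ?_
    have := Polynomial.isIntegral_coeff_of_dvd (minpoly M z) (minpoly N z)
      (minpoly.monic hz.isIntegral) (minpoly.monic hzN.isIntegral)
      (minpoly.dvd_map_of_isScalarTower M N z) j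
    exact (this.algebraMap (B := Ω)).isAlgebraic
  have heq : minpoly N z = (minpoly M z).map (algebraMap M N) :=
    minpoly_eq_map_of_forall_coeff_mem hz fun j => ⟨⟨_, hmem j⟩, rfl⟩
  have h1 := norm_coeff_minpoly_le_of_isClosed N M.isClosed_topologicalClosure hzN i
  rw [heq, natDegree_map, coeff_map] at h1
  exact h1 hi

theorem pow_card_le_norm_multiset_prod {z : Ω} {r : ℝ} (hr : 0 ≤ r) {s : Multiset Ω}
    (hs : ∀ a ∈ s, r ≤ ‖z - a‖) : r ^ s.card ≤ ‖(s.map (z - ·)).prod‖ := by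
  induction s using Multiset.induction_on with
  | empty => simp
  | cons a s ih =>
    rw [Multiset.card_cons, Multiset.map_cons, Multiset.prod_cons, norm_mul, pow_succ']
    exact mul_le_mul (hs a (Multiset.mem_cons_self a s))
      (ih fun b hb => hs b (Multiset.mem_cons_of_mem hb)) (by positivity) (norm_nonneg _)

variable {D : Derivation ℤ Ω Ω} {C : ℝ}

theorem natDegree_minpoly_sub {M : Subfield Ω} {y b : Ω} (hb : b ∈ M) :
    (minpoly M (y - b)).natDegree = (minpoly M y).natDegree := by
  have := minpoly.sub_algebraMap (A := M) y ⟨b, hb⟩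
  change minpoly M (y - b) = _ at this
  rw [this, natDegree_comp, natDegree_X_add_C, mul_one]

theorem norm_deriv_le_of_minimal [CompleteSpace Ω] [IsUltrametricDist Ω] [IsAlgClosed Ω]
    (hres : ∀ n : ℕ, n ≠ 0 → ‖(n : Ω)‖ = 1) {M : Subfield Ω}
    (hC : 0 ≤ C) (hgood : ∀ z ∈ M, ‖D z‖ ≤ C * ‖z‖)
    (hM : ∀ w ∈ closure (M : Set Ω), IsAlgebraic M w → w ∈ M) {y : Ω} (hy : IsAlgebraic M y)
    (hmin : ∀ w, IsAlgebraic M w → (minpoly M w).natDegree < (minpoly M y).natDegree → w ∈ M) :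
    ‖D y‖ ≤ C * ‖y‖ := by
  set n := (minpoly M y).natDegree with hn
  have hn0 : n ≠ 0 := (minpoly.natDegree_pos hy.isIntegral).ne'
  have hnΩ : ‖(n : Ω)‖ = 1 := hres n hn0
  have hnΩ0 : (n : Ω) ≠ 0 := fun h => by simp [h] at hnΩ
  set h : Ω := -((minpoly M y).coeff (n - 1) : Ω) / n with hh
  have hhM : h ∈ M := div_mem (neg_mem (SetLike.coe_mem _)) (natCast_mem M n)
  have hdist : ∀ b ∈ M, ‖b - h‖ ≤ ‖y - b‖ := fun b hb => by
    have hyb : IsAlgebraic M (y - b) := hy.sub (isAlgebraic_algebraMap (⟨b, hb⟩ : M))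
    have h1 := norm_coeff_minpoly_le M hM hyb (n - 1)
    rw [natDegree_minpoly_sub hb, ← hn, Nat.sub_sub_self (Nat.one_le_iff_ne_zero.2 hn0),
      pow_one] at h1
    refine le_trans (le_of_eq ?_) (h1 (by omega))
    have h2 : minpoly M (y - b) = taylor ⟨b, hb⟩ (minpoly M y) :=
      minpoly.sub_algebraMap (A := M) y ⟨b, hb⟩
    rw [h2, hn, coeff_taylor_natDegree_sub_one (minpoly.monic hy.isIntegral) (hn ▸ hn0), ← hn]
    have : b - h = (((minpoly M y).coeff (n - 1) + n * ⟨b, hb⟩ : M) : Ω) / n := by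
      rw [hh]; push_cast; field_simp; ring
    rw [this, norm_div, hnΩ, div_one]
  set z := y - h with hz
  have hza : IsAlgebraic M z := hy.sub (isAlgebraic_algebraMap (⟨h, hhM⟩ : M))
  have hzn : (minpoly M z).natDegree = n := natDegree_minpoly_sub hhM
  have hdz : ∀ b ∈ M, ‖z‖ ≤ ‖z - b‖ := fun b hb => by
    have h1 := hdist (h + b) (add_mem hhM hb)
    rw [add_sub_cancel_left, ← sub_sub] at h1
    calc ‖z‖ = ‖(z - b) + b‖ := by rw [sub_add_cancel]
      _ ≤ max ‖z - b‖ ‖b‖ := IsUltrametricDist.norm_add_le_max _ _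
      _ ≤ ‖z - b‖ := max_le le_rfl h1
  have hDz : ‖D z‖ ≤ C * ‖z‖ := by
    rcases eq_or_ne z 0 with h0 | h0
    · simp [h0]
    have hzpos := norm_pos_iff.2 h0
    set P := (minpoly M z).map (algebraMap M Ω) with hP
    have hPm : P.Monic := (minpoly.monic hza.isIntegral).map _
    have hPn : P.natDegree = n := by rw [hP, natDegree_map, hzn]
    have hPz : P.eval z = 0 := by rw [hP, eval_map_algebraMap, minpoly.aeval]
    have h1 := D.apply_eval_eq_sum P z
    rw [hPz, map_zero, Finset.sum_range_succ, hPm.coeff_natDegree, D.map_one_eq_zero, zero_mul,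
      add_zero, hPn] at h1
    have hsum : ‖∑ i ∈ Finset.range n, D (P.coeff i) * z ^ i‖ ≤ C * ‖z‖ ^ n := by
      refine IsUltrametricDist.norm_sum_le_of_forall_le_of_nonneg (by positivity) fun i hi => ?_
      have hi := Finset.mem_range.1 hi
      have h2 := norm_coeff_minpoly_le M hM hza i (hzn ▸ hi)
      rw [hzn] at h2
      have h3 : P.coeff i = ((minpoly M z).coeff i : Ω) := by rw [hP, coeff_map]; rfl
      calc ‖D (P.coeff i) * z ^ i‖ = ‖D (P.coeff i)‖ * ‖z‖ ^ i := by rw [norm_mul, norm_pow]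
        _ ≤ C * ‖z‖ ^ (n - i) * ‖z‖ ^ i := by
          gcongr
          rw [h3]
          exact (hgood _ (SetLike.coe_mem _)).trans (by gcongr)
        _ = C * ‖z‖ ^ n := by rw [mul_assoc, ← pow_add, Nat.sub_add_cancel hi.le]
    have hderiv : ‖z‖ ^ (n - 1) ≤ ‖P.derivative.eval z‖ := by
      set Q := (minpoly M z).derivative with hQ
      have hM0 : (n : M) ≠ 0 := fun h => hnΩ0 (congrArg Subtype.val h)
      have hQn1 : Q.coeff (n - 1) = n := by
        rw [hQ, coeff_derivative, Nat.sub_add_cancel (Nat.one_le_iff_ne_zero.2 hn0)]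
        have : (minpoly M z).coeff n = 1 := by
          rw [← hzn]; exact (minpoly.monic hza.isIntegral).coeff_natDegree
        rw [this, one_mul]
        have := congrArg (Nat.cast (R := M)) (Nat.sub_add_cancel (Nat.one_le_iff_ne_zero.2 hn0))
        exact_mod_cast this
      have hQle : Q.natDegree ≤ n - 1 := hzn ▸ natDegree_derivative_le _
      have hQn : Q.natDegree = n - 1 :=
        natDegree_eq_of_le_of_coeff_ne_zero hQle (by rw [hQn1]; exact hM0)
      have hQ0 : Q ≠ 0 := fun h => by rw [h, coeff_zero] at hQn1; exact hM0 hQn1.symm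
      have hQP : P.derivative = Q.map (algebraMap M Ω) := by rw [hP, derivative_map]
      have hspl := IsAlgClosed.splits (Q.map (algebraMap M Ω))
      have hcard : (Q.aroots Ω).card = n - 1 := by
        rw [aroots_def, ← hspl.natDegree_eq_card_roots, natDegree_map, hQn]
      rw [hQP, hspl.eval_eq_prod_roots, leadingCoeff_map, leadingCoeff, hQn, hQn1, norm_mul,
        map_natCast, hnΩ, one_mul, ← aroots_def, ← hcard]
      have : ∀ a ∈ Q.aroots Ω, ‖z‖ ≤ ‖z - a‖ := fun a ha => by
        rw [mem_aroots] at ha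
        refine hdz a (hmin a ⟨Q, ha⟩ ?_)
        have := natDegree_le_natDegree (minpoly.degree_le_of_ne_zero M a hQ0 ha.2)
        omega
      exact pow_card_le_norm_multiset_prod (norm_nonneg z) this
    have h4 : ‖P.derivative.eval z * D z‖ ≤ C * ‖z‖ ^ n := by
      rw [← neg_eq_of_add_eq_zero_right h1.symm, norm_neg]; exact hsum
    rw [norm_mul] at h4
    have h5 : ‖z‖ ^ (n - 1) * ‖D z‖ ≤ ‖z‖ ^ (n - 1) * (C * ‖z‖) := by
      calc _ ≤ ‖P.derivative.eval z‖ * ‖D z‖ := by gcongr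
        _ ≤ C * ‖z‖ ^ n := h4
        _ = _ := by rw [← mul_pow_sub_one hn0]; ring
    exact le_of_mul_le_mul_left h5 (by positivity)
  have hhy : ‖h‖ ≤ ‖y‖ := by simpa using hdist 0 (zero_mem M)
  have hzy : ‖z‖ ≤ ‖y‖ := by simpa [hz] using hdz (-h) (neg_mem hhM)
  calc ‖D y‖ = ‖D z + D h‖ := by rw [← map_add, hz, sub_add_cancel]
    _ ≤ max ‖D z‖ ‖D h‖ := IsUltrametricDist.norm_add_le_max _ _
    _ ≤ C * ‖y‖ := max_le (hDz.trans (by gcongr)) ((hgood h hhM).trans (by gcongr))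

end

section
variable {Ω : Type*} [NormedField Ω] {D : Derivation ℤ Ω Ω} {C : ℝ}

theorem exists_aeval_eq_of_mem_adjoin_simple {k E : Type*} [Field k] [Field E] [Algebra k E] {y : E}
    (hy : IsIntegral k y) {z : E} (hz : z ∈ IntermediateField.adjoin k {y}) :
    ∃ f : k[X], f.natDegree < (minpoly k y).natDegree ∧ z = aeval y f := by
  obtain ⟨f, hf, h⟩ := (IntermediateField.adjoin.powerBasis hy).exists_eq_aeval ⟨z, hz⟩
  refine ⟨f, by simpa using hf, ?_⟩
  have := congrArg (algebraMap _ E) h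
  rw [← aeval_algebraMap_apply] at this
  simpa using this

theorem norm_deriv_le_of_isAlgebraic [CharZero Ω] [CompleteSpace Ω] [IsUltrametricDist Ω]
    [IsAlgClosed Ω] (hres : ∀ n : ℕ, n ≠ 0 → ‖(n : Ω)‖ = 1) {H : Subfield Ω}
    (hC : 0 ≤ C) (hH : ∀ z ∈ H, ‖D z‖ ≤ C * ‖z‖) {z : Ω} (hz : IsAlgebraic H z) :
    ‖D z‖ ≤ C * ‖z‖ := by
  let S : Set (Subfield Ω) := {M | H ≤ M ∧ ∀ z ∈ M, IsAlgebraic H z ∧ ‖D z‖ ≤ C * ‖z‖}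
  have hHS : H ∈ S := ⟨le_rfl, fun z hz => ⟨isAlgebraic_algebraMap (⟨z, hz⟩ : H), hH z hz⟩⟩
  obtain ⟨M, hHM, hMS, hmax⟩ := zorn_le_nonempty₀ S (fun c hcS hc N hN => by
    refine ⟨sSup c, ⟨(hcS hN).1.trans (le_sSup hN), fun z hz => ?_⟩, fun _ => le_sSup⟩
    obtain ⟨N', hN', hz'⟩ := (Subfield.mem_sSup_of_directedOn ⟨N, hN⟩ hc.directedOn).1 hz
    exact (hcS hN').2 z hz') H hHS
  have hMalg : ∀ z, IsAlgebraic M z → IsAlgebraic H z := fun z hz =>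
    hz.trans_subfield hHM fun w hw => (hMS.2 w hw).1
  have hgood : ∀ z ∈ M, ‖D z‖ ≤ C * ‖z‖ := fun z hz => (hMS.2 z hz).2
  have hmax' : ∀ N : Subfield Ω, M ≤ N → (∀ z ∈ N, IsAlgebraic M z ∧ ‖D z‖ ≤ C * ‖z‖) → N ≤ M :=
    fun N hMN hN => hmax ⟨hHM.trans hMN, fun z hz => ⟨hMalg z (hN z hz).1, (hN z hz).2⟩⟩ hMN
  have hclosed : ∀ w ∈ closure (M : Set Ω), IsAlgebraic M w → w ∈ M := fun w hw hwa => by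
    refine hmax' (M.topologicalClosure ⊓ (algebraicClosure M Ω).toSubfield)
      (le_inf M.le_topologicalClosure fun z hz => (algebraicClosure M Ω).algebraMap_mem ⟨z, hz⟩)
      (fun z hz => ?_) ⟨hw, mem_algebraicClosure_iff.2 hwa⟩
    have hza : IsAlgebraic M z := mem_algebraicClosure_iff.1 hz.2
    exact ⟨hza, norm_deriv_le_of_mem_closure hgood hza hz.1⟩
  suffices ∀ y, IsAlgebraic M y → y ∈ M from hgood z (this z (hz.of_subfield_le hHM))
  by_contra! hne
  obtain ⟨y, ⟨hya, hyM⟩, hymin⟩ := WellFounded.has_min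
    (InvImage.wf (fun y : Ω => (minpoly M y).natDegree) wellFounded_lt)
    {y | IsAlgebraic M y ∧ y ∉ M} hne
  have hmin : ∀ w, IsAlgebraic M w → (minpoly M w).natDegree < (minpoly M y).natDegree → w ∈ M :=
    fun w hw hlt => by_contra fun hwM => hymin w ⟨hw, hwM⟩ hlt
  have hyC : ∀ a ∈ M, ‖D (y - a)‖ ≤ C * ‖y - a‖ := fun a ha => by
    refine norm_deriv_le_of_minimal hres hC hgood hclosed
      (hya.sub (isAlgebraic_algebraMap (⟨a, ha⟩ : M))) fun w hw hlt => hmin w hw ?_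
    rwa [natDegree_minpoly_sub ha] at hlt
  refine hyM (hmax' (IntermediateField.adjoin M {y}).toSubfield
    (fun z hz => (IntermediateField.adjoin M {y}).algebraMap_mem ⟨z, hz⟩) (fun z hz => ?_)
    (IntermediateField.mem_adjoin_simple_self M y))
  obtain ⟨f, hf, rfl⟩ := exists_aeval_eq_of_mem_adjoin_simple hya.isIntegral hz
  refine ⟨?_, norm_deriv_aeval_le hC hgood hyC f fun a ha => ?_⟩
  · exact mem_algebraicClosure_iff.1
      (IntermediateField.adjoin_simple_le_iff.2 (mem_algebraicClosure_iff.2 hya) hz)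
  · rw [mem_aroots] at ha
    exact hmin a ⟨f, ha⟩ ((natDegree_le_natDegree
      (minpoly.degree_le_of_ne_zero M a ha.1 ha.2)).trans_lt hf)

end

section
variable {Ω : Type*} [Field Ω]

/-- The subfield of elements algebraic over the subfield generated by `A`. -/
def algClosureOf (A : Set Ω) : Subfield Ω :=
  (algebraicClosure (Subfield.closure A) Ω).toSubfield

theorem mem_algClosureOf {A : Set Ω} {x : Ω} :
    x ∈ algClosureOf A ↔ IsAlgebraic (Subfield.closure A) x :=
  mem_algebraicClosure_iff

theorem closure_le_algClosureOf (A : Set Ω) : Subfield.closure A ≤ algClosureOf A :=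
  fun z hz => (algebraicClosure (Subfield.closure A) Ω).algebraMap_mem ⟨z, hz⟩

theorem subset_algClosureOf (A : Set Ω) : A ⊆ algClosureOf A :=
  Subfield.subset_closure.trans (closure_le_algClosureOf A)

theorem mem_algClosureOf_of_isAlgebraic {A : Set Ω} {x : Ω} (hx : IsAlgebraic (algClosureOf A) x) :
    x ∈ algClosureOf A :=
  mem_algClosureOf.2 (hx.trans_subfield (closure_le_algClosureOf A) fun _ => mem_algClosureOf.1)

theorem algClosureOf_le {A : Set Ω} {k : Subfield Ω} (hk : ∀ x, IsAlgebraic k x → x ∈ k)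
    (h : A ⊆ k) : algClosureOf A ≤ k :=
  fun _ hx => hk _ ((mem_algClosureOf.1 hx).of_subfield_le (Subfield.closure_le.2 h))

theorem algClosureOf_mono {A B : Set Ω} (h : A ⊆ algClosureOf B) :
    algClosureOf A ≤ algClosureOf B :=
  algClosureOf_le (fun _ => mem_algClosureOf_of_isAlgebraic) h

theorem matroid_closure_eq_algClosureOf [CharZero Ω] (A : Set Ω) :
    (AlgebraicIndependent.matroid ℤ Ω).closure A = algClosureOf A := by
  rw [AlgebraicIndependent.matroid_closure_eq]
  let R := Algebra.adjoin ℤ A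
  let k : Subfield Ω :=
    { (Subalgebra.algebraicClosure R Ω).toSubring with
      inv_mem' := fun x (hx : IsAlgebraic R x) => (hx.inv : IsAlgebraic R x⁻¹) }
  have hk : Subfield.closure A ≤ k := Subfield.closure_le.2 fun a ha =>
    isAlgebraic_algebraMap (⟨a, Algebra.subset_adjoin ha⟩ : R)
  have hR : R ≤ subalgebraOfSubring (Subfield.closure A).toSubring :=
    Algebra.adjoin_le Subfield.subset_closure
  let _ : Algebra R (Subfield.closure A) := (Subalgebra.inclusion hR).toRingHom.toAlgebra
  have : IsScalarTower R (Subfield.closure A) Ω := .of_algebraMap_eq fun _ => rfl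
  have : Algebra.IsAlgebraic R (Subfield.closure A) := ⟨fun z =>
    (isAlgebraic_algebraMap_iff (A := Ω) Subtype.val_injective).1 (hk z.2)⟩
  ext x
  rw [SetLike.mem_coe, SetLike.mem_coe, mem_algClosureOf]
  exact ⟨fun h => IsAlgebraic.extendScalars (R := R) (Subalgebra.inclusion_injective hR) h,
    fun h => h.restrictScalars R⟩

theorem mem_algClosureOf_exchange [CharZero Ω] {A : Set Ω} {x t : Ω} (hx : x ∉ algClosureOf A)
    (h : x ∈ algClosureOf (insert t A)) : t ∈ algClosureOf (insert x A) := by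
  rw [← SetLike.mem_coe, ← matroid_closure_eq_algClosureOf] at *
  exact Matroid.mem_closure_insert hx h

end

section
variable {Ω : Type*} [NormedField Ω]

theorem exists_pos_forall_le_norm_sub {k : Subfield Ω} {x : Ω} (hx : x ∉ k.topologicalClosure) :
    ∃ d > 0, ∀ c ∈ k, d ≤ ‖x - c‖ := by
  have : x ∉ closure (k : Set Ω) := hx
  rw [Metric.mem_closure_iff] at this
  push Not at this
  simpa only [dist_eq_norm, SetLike.mem_coe] using this

theorem exists_derivation_apply_eq_one [CharZero Ω] {k : Subfield Ω} {t : Ω}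
    (ht : ¬ IsAlgebraic k t) : ∃ D : Derivation ℤ Ω Ω, D t = 1 ∧ ∀ c ∈ k, D c = 0 := by
  obtain ⟨D, hD⟩ := exists_derivation_of_transcendental (F := k) ht
  exact ⟨D.restrictScalars ℤ, hD, fun c hc => D.map_algebraMap (⟨c, hc⟩ : k)⟩

theorem norm_deriv_le_of_mem_algClosureOf_insert [CharZero Ω] [CompleteSpace Ω]
    [IsUltrametricDist Ω] [IsAlgClosed Ω] (hres : ∀ n : ℕ, n ≠ 0 → ‖(n : Ω)‖ = 1)
    {A : Set Ω} {t : Ω} {D : Derivation ℤ Ω Ω} (hD : ∀ c ∈ algClosureOf A, D c = 0) {s : ℝ}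
    (hs : 0 < s) (ht : ∀ c ∈ algClosureOf A, s * ‖D t‖ ≤ ‖t - c‖) {z : Ω}
    (hz : z ∈ algClosureOf (insert t A)) : ‖D z‖ ≤ s⁻¹ * ‖z‖ := by
  let H := (IntermediateField.adjoin (algClosureOf A) {t}).toSubfield
  have hAH : ∀ c ∈ algClosureOf A, c ∈ H := fun c hc =>
    (IntermediateField.adjoin (algClosureOf A) {t}).algebraMap_mem ⟨c, hc⟩
  have hzH : IsAlgebraic H z := (mem_algClosureOf.1 hz).of_subfield_le <| Subfield.closure_le.2 <|
    Set.insert_subset (IntermediateField.mem_adjoin_simple_self _ t)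
      fun a ha => hAH a (subset_algClosureOf A ha)
  have hs' : 0 ≤ s⁻¹ := by positivity
  refine norm_deriv_le_of_isAlgebraic hres hs' (fun w hw => ?_) hzH
  have hpoly (f : (algClosureOf A)[X]) : ‖D (aeval t f)‖ ≤ s⁻¹ * ‖aeval t f‖ := by
    rcases eq_or_ne f 0 with rfl | hf
    · simp
    refine norm_deriv_aeval_le hs' (fun c hc => ?_) (fun c hc => ?_) f fun a ha => ?_
    · rw [hD c hc, norm_zero]; positivity
    · rw [map_sub, hD c hc, sub_zero, inv_mul_eq_div, le_div_iff₀' hs]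
      exact ht c hc
    · exact mem_algClosureOf_of_isAlgebraic ⟨f, mem_aroots.1 ha⟩
  obtain ⟨p, q, rfl⟩ := (IntermediateField.mem_adjoin_simple_iff _ w).1 hw
  rw [div_eq_mul_inv]
  exact norm_deriv_mul_le (hpoly p) (norm_deriv_inv_le (hpoly q))

/-- The completed algebraic closure of the subfield generated by `A`. -/
def topAlgClosureOf (A : Set Ω) : Subfield Ω :=
  (algClosureOf A).topologicalClosure

theorem algClosureOf_le_topAlgClosureOf (A : Set Ω) : algClosureOf A ≤ topAlgClosureOf A :=
  Subfield.le_topologicalClosure _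

theorem subset_topAlgClosureOf (A : Set Ω) : A ⊆ topAlgClosureOf A :=
  fun _ hx => algClosureOf_le_topAlgClosureOf A (subset_algClosureOf A hx)

theorem isClosed_topAlgClosureOf (A : Set Ω) : IsClosed (topAlgClosureOf A : Set Ω) :=
  Subfield.isClosed_topologicalClosure _

theorem mem_topAlgClosureOf_exchange [CharZero Ω] [CompleteSpace Ω]
    [IsUltrametricDist Ω] [IsAlgClosed Ω] (hres : ∀ n : ℕ, n ≠ 0 → ‖(n : Ω)‖ = 1)
    {A : Set Ω} {x t : Ω} (hx : x ∉ topAlgClosureOf A) (h : x ∈ topAlgClosureOf (insert t A)) :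
    t ∈ topAlgClosureOf (insert x A) := by
  by_contra ht
  obtain ⟨d, hd, hxd⟩ := exists_pos_forall_le_norm_sub hx
  obtain ⟨r, hr, htr⟩ := exists_pos_forall_le_norm_sub ht
  set m := algClosureOf (insert x A)
  have hkm : algClosureOf A ≤ m :=
    algClosureOf_mono ((Set.subset_insert x A).trans (subset_algClosureOf _))
  have hxm : x ∈ m := subset_algClosureOf _ (Set.mem_insert x A)
  obtain ⟨D, hDt, hDm⟩ := exists_derivation_apply_eq_one (k := m) (t := t) fun h =>
    ht (algClosureOf_le_topAlgClosureOf _ (mem_algClosureOf_of_isAlgebraic h))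
  have ht0 : 0 < ‖t‖ := by simpa using hr.trans_le (htr 0 (zero_mem m))
  obtain ⟨y, hy, hxy⟩ := Metric.mem_closure_iff.1 h (min d (r * d / ‖t‖)) (by positivity)
  rw [dist_eq_norm, lt_min_iff] at hxy
  have hyd : ∀ c ∈ algClosureOf A, d ≤ ‖y - c‖ := fun c hc => by
    have := IsUltrametricDist.norm_add_le_max (x - y) (y - c)
    rw [sub_add_sub_cancel] at this
    exact (le_max_iff.1 ((hxd c hc).trans this)).resolve_left hxy.1.not_ge
  have hyA : y ∉ algClosureOf A := fun hyA => by
    have := hyd y hyA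
    rw [sub_self, norm_zero] at this
    exact this.not_gt hd
  have hty : t ∈ algClosureOf (insert y A) := mem_algClosureOf_exchange hyA hy
  have hDy : ‖D y‖ ≤ r⁻¹ * ‖x - y‖ := by
    have h1 : y - x ∈ algClosureOf (insert t (m : Set Ω)) :=
      sub_mem (algClosureOf_mono ((Set.insert_subset_insert fun a ha =>
        hkm (subset_algClosureOf A ha)).trans (subset_algClosureOf _)) hy)
        (subset_algClosureOf _ (Set.mem_insert_of_mem _ hxm))
    have hmm : algClosureOf (m : Set Ω) ≤ m :=
      algClosureOf_le (fun _ => mem_algClosureOf_of_isAlgebraic) le_rfl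
    have h2 := norm_deriv_le_of_mem_algClosureOf_insert hres (fun c hc => hDm c (hmm hc)) hr
      (fun c hc => by rw [hDt, norm_one, mul_one]; exact htr c (hmm hc)) h1
    rwa [map_sub, hDm x hxm, sub_zero, norm_sub_rev] at h2
  have hDy0 : 0 < ‖D y‖ := by
    by_contra! h0
    have h2 := norm_deriv_le_of_mem_algClosureOf_insert hres (s := ‖t‖ + 1)
      (fun c hc => hDm c (hkm hc)) (by positivity)
      (fun c hc => (mul_nonpos_of_nonneg_of_nonpos (by positivity) h0).trans (norm_nonneg _)) hty
    rw [hDt, norm_one, inv_mul_eq_div, le_div_iff₀ (by positivity)] at h2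
    linarith
  have h3 := norm_deriv_le_of_mem_algClosureOf_insert hres (s := d / ‖D y‖)
    (fun c hc => hDm c (hkm hc)) (by positivity)
    (fun c hc => by rw [div_mul_cancel₀ _ hDy0.ne']; exact hyd c hc) hty
  rw [hDt, norm_one, inv_div, div_mul_eq_mul_div, le_div_iff₀ hd, one_mul] at h3
  have h4 := hxy.2
  rw [lt_div_iff₀ ht0] at h4
  rw [inv_mul_eq_div, le_div_iff₀ hr] at hDy
  nlinarith

end

section
variable {Ω : Type*} [NormedField Ω] [IsAlgClosed Ω]

theorem mem_topologicalClosure_of_isAlgebraic {k : Subfield Ω} (hk : ∀ x, IsAlgebraic k x → x ∈ k)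
    {x : Ω} (hx : IsAlgebraic k.topologicalClosure x) : x ∈ k.topologicalClosure := by
  let N := k.topologicalClosure
  have hkN : k ≤ N := k.le_topologicalClosure
  let _ : Algebra k N := (Subfield.inclusion hkN).toAlgebra
  have : IsScalarTower k N Ω := .of_algebraMap_eq fun _ => rfl
  have hd : DenseRange (algebraMap k N) := fun z => by
    rw [closure_subtype, ← Set.range_comp]
    have : Set.range (Subtype.val ∘ algebraMap k N) = (k : Set Ω) := Subtype.range_coe
    rw [this]
    exact z.2
  set f := minpoly N x with hf
  have hfm : f.Monic := minpoly.monic hx.isIntegral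
  have hn : (f.natDegree : ℝ) ≠ 0 := by exact_mod_cast (minpoly.natDegree_pos hx.isIntegral).ne'
  refine Metric.mem_closure_iff.2 fun ε hε => ?_
  have hε' : 0 < (ε / max ‖x‖ 1) ^ (f.natDegree : ℝ) / (f.natDegree + 1) := by positivity
  obtain ⟨g, hgm, hgd, hg⟩ :=
    exists_monic_and_natDegree_eq_and_norm_map_algebraMap_coeff_sub_lt hd hfm hε'
  obtain ⟨b, hb, hxb⟩ := exists_aroots_norm_sub_lt_of_norm_coeff_sub_lt (K := Ω) (L := Ω)
    (f := f.map (algebraMap N Ω)) (g := (g.map (algebraMap k N)).map (algebraMap N Ω)) hε'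
    (by rw [aeval_map_algebraMap, hf, minpoly.aeval]) (hfm.map _) ((hgm.map _).map _)
    (by simp only [natDegree_map, hgd]) (fun i => by
      rw [coeff_map (algebraMap N Ω), coeff_map (p := f), ← map_sub]
      exact hg i) (IsAlgClosed.splits _)
  refine ⟨b, hk b ⟨g, hgm.ne_zero, ?_⟩, ?_⟩
  · simpa [aeval_map_algebraMap] using (mem_aroots.1 hb).2
  · rw [natDegree_map, mul_div_cancel₀ _ (by positivity), Real.rpow_rpow_inv (by positivity) hn,
      div_mul_cancel₀ _ (by positivity)] at hxb
    rwa [dist_eq_norm]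

theorem mem_topAlgClosureOf_of_isAlgebraic {A : Set Ω} {x : Ω}
    (hx : IsAlgebraic (topAlgClosureOf A) x) : x ∈ topAlgClosureOf A :=
  mem_topologicalClosure_of_isAlgebraic (fun _ => mem_algClosureOf_of_isAlgebraic) hx

theorem topAlgClosureOf_le {A B : Set Ω} (h : A ⊆ topAlgClosureOf B) :
    topAlgClosureOf A ≤ topAlgClosureOf B :=
  Subfield.topologicalClosure_minimal _
    (algClosureOf_le (fun _ => mem_topAlgClosureOf_of_isAlgebraic) h) (isClosed_topAlgClosureOf B)

end

namespace ClosureOperator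

variable {α : Type*} (c : ClosureOperator (Set α))

/-- `S` is independent over `K`: no element of `S` lies in the closure of `K` and the others. -/
def IndepOver (K S : Set α) : Prop :=
  ∀ x ∈ S, x ∉ c (K ∪ S \ {x})

/-- The supremum of the cardinalities of the subsets of `L` independent over `K`. -/
noncomputable def indepRank (K L : Set α) : Cardinal :=
  ⨆ S : {S : Set α // S ⊆ L ∧ c.IndepOver K S}, Cardinal.mk S.1

variable {c}

theorem closure_le_of_subset {A B : Set α} (h : A ⊆ c B) : c A ⊆ c B :=
  (c.le_closure_iff (x := A) (y := B)).1 h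

theorem IndepOver.mono {K S T : Set α} (hT : c.IndepOver K T) (h : S ⊆ T) : c.IndepOver K S :=
  fun x hx hxc => hT x (h hx) <|
    c.monotone (Set.union_subset_union_right K (Set.sdiff_subset_sdiff_left h)) hxc

theorem mk_le_indepRank {K L S : Set α} (hS : S ⊆ L) (hK : c.IndepOver K S) :
    Cardinal.mk S ≤ c.indepRank K L :=
  le_ciSup (f := fun S : {S : Set α // S ⊆ L ∧ c.IndepOver K S} => Cardinal.mk S.1)
    (Cardinal.bddAbove_of_small) ⟨S, hS, hK⟩

theorem indepRank_mono {K L F : Set α} (h : L ⊆ F) : c.indepRank K L ≤ c.indepRank K F :=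
  ciSup_le' fun S => mk_le_indepRank (S.2.1.trans h) S.2.2

/-- The exchange property of a closure operator. -/
def HasExchange (c : ClosureOperator (Set α)) : Prop :=
  ∀ ⦃A : Set α⦄ ⦃x t : α⦄, x ∉ c A → x ∈ c (insert t A) → t ∈ c (insert x A)

variable (hc : c.HasExchange)
include hc

theorem IndepOver.insert {K S : Set α} (hS : c.IndepOver K S) {b : α} (hb : b ∉ c (K ∪ S)) :
    c.IndepOver K (insert b S) := by
  intro x hx hxc
  have hbS : b ∉ S := fun h => hb (c.le_closure _ (Or.inr h))
  rcases eq_or_ne x b with rfl | hne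
  · rw [Set.insert_sdiff_self_of_notMem hbS] at hxc
    exact hb hxc
  · have hxS : x ∈ S := hx.resolve_left hne
    rw [← Set.insert_sdiff_singleton_comm hne.symm, Set.union_insert] at hxc
    refine hb (c.monotone ?_ (hc (hS x hxS) hxc))
    rw [← Set.union_insert, Set.insert_sdiff_self_of_mem hxS]

theorem IndepOver.card_le {K : Set α} {S B : Finset α} (hS : c.IndepOver K S)
    (hB : (S : Set α) ⊆ c (K ∪ B)) : S.card ≤ B.card := by
  classical
  induction hn : (S \ B).card generalizing S with
  | zero =>
    rw [Finset.card_eq_zero, Finset.sdiff_eq_empty_iff_subset] at hn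
    exact Finset.card_le_card hn
  | succ n ih =>
    obtain ⟨x, hx⟩ := Finset.card_pos.1 (by omega : 0 < (S \ B).card)
    obtain ⟨hxS, hxB⟩ := Finset.mem_sdiff.1 hx
    have hxc := hS x hxS
    obtain ⟨b, hbB, hb⟩ : ∃ b ∈ B, b ∉ c (K ∪ (S : Set α) \ {x}) := by
      by_contra! h
      exact hxc (closure_le_of_subset
        (Set.union_subset (Set.subset_union_left.trans (c.le_closure _)) h) (hB hxS))
    have hbS : b ∉ S := fun hbS => by
      have hbx : b ≠ x := fun h => hxB (h ▸ hbB)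
      exact hb (c.le_closure _ (Or.inr ⟨hbS, hbx⟩))
    have hcard : (Insert.insert b (S.erase x)).card = S.card := by
      rw [Finset.card_insert_of_notMem fun h => hbS (Finset.mem_of_mem_erase h),
        Finset.card_erase_add_one hxS]
    rw [← hcard]
    refine ih ?_ ?_ ?_
    · rw [Finset.coe_insert, Finset.coe_erase]
      exact (hS.mono Set.sdiff_subset).insert hc hb
    · rw [Finset.coe_insert, Finset.coe_erase]
      exact Set.insert_subset (c.le_closure _ (Or.inr hbB)) (Set.sdiff_subset.trans hB)
    · rw [Finset.insert_sdiff_of_mem _ hbB, Finset.erase_sdiff_comm, Finset.card_erase_of_mem hx,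
        hn, Nat.add_sub_cancel]

theorem indepRank_le_card {K L : Set α} {B : Finset α} (hB : L ⊆ c (K ∪ B)) :
    c.indepRank K L ≤ B.card := by
  refine ciSup_le' fun S => Cardinal.mk_le_iff_forall_finset_subset_card_le.2 fun s hs => ?_
  exact (S.2.2.mono hs).card_le hc ((hs.trans S.2.1).trans hB)

theorem indepRank_eq_card {K L : Set α} {B : Finset α} (hBL : (B : Set α) ⊆ L)
    (hB : c.IndepOver K B) (h : L ⊆ c (K ∪ B)) : c.indepRank K L = B.card :=
  (indepRank_le_card hc h).antisymm (by simpa using mk_le_indepRank hBL hB)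

theorem exists_basis_of_indepRank_lt {K L : Set α} (h : c.indepRank K L < Cardinal.aleph0)
    {T : Finset α} (hTL : (T : Set α) ⊆ L) (hT : c.IndepOver K T) :
    ∃ B : Finset α, T ⊆ B ∧ (B : Set α) ⊆ L ∧ c.IndepOver K B ∧ L ⊆ c (K ∪ B) := by
  classical
  obtain ⟨n, hn⟩ := Cardinal.lt_aleph0.1 h
  have hle : ∀ B : Finset α, (B : Set α) ⊆ L → c.IndepOver K B → B.card ≤ n := fun B hBL hB => by
    have := mk_le_indepRank hBL hB
    rw [hn] at this
    simpa using this
  obtain ⟨B, ⟨hTB, hBL, hB⟩, hmin⟩ := WellFounded.has_min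
    (InvImage.wf (fun B : Finset α => n - B.card) wellFounded_lt)
    {B | T ⊆ B ∧ (B : Set α) ⊆ L ∧ c.IndepOver K B} ⟨T, Finset.Subset.refl T, hTL, hT⟩
  refine ⟨B, hTB, hBL, hB, fun b hbL => by_contra fun hb => ?_⟩
  have hbB : b ∉ B := fun h => hb (c.le_closure _ (Or.inr h))
  have h1 : ((Insert.insert b B : Finset α) : Set α) ⊆ L := by
    rw [Finset.coe_insert]; exact Set.insert_subset hbL hBL
  have h2 : c.IndepOver K (Insert.insert b B : Finset α) := by
    rw [Finset.coe_insert]; exact hB.insert hc hb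
  have h3 := hle _ h1 h2
  refine hmin _ ⟨hTB.trans (Finset.subset_insert b B), h1, h2⟩ ?_
  rw [Finset.card_insert_of_notMem hbB] at h3
  simp only [InvImage, Finset.card_insert_of_notMem hbB]
  omega

theorem indepRank_add_of_lt {K L F : Set α} (hKL : K ⊆ L) (hLF : L ⊆ F)
    (h : c.indepRank K F < Cardinal.aleph0) :
    c.indepRank K F = c.indepRank L F + c.indepRank K L := by
  classical
  obtain ⟨T, -, hTL, hT, hLT⟩ := exists_basis_of_indepRank_lt hc (T := ∅)
    ((indepRank_mono hLF).trans_lt h) (by simp) (by simp [IndepOver])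
  obtain ⟨B, hTB, hBF, hB, hFB⟩ := exists_basis_of_indepRank_lt hc h (hTL.trans hLF) hT
  have hind : c.IndepOver L (B \ T : Finset α) := fun x hx hxc => by
    rw [Finset.coe_sdiff] at hx hxc
    have hTx : (T : Set α) ⊆ B \ {x} := fun y hy => ⟨hTB hy, fun hyx => hx.2 (hyx ▸ hy)⟩
    refine hB x hx.1 (closure_le_of_subset (Set.union_subset ?_ ?_) hxc)
    · exact hLT.trans (c.monotone (Set.union_subset_union_right K hTx))
    · exact (Set.sdiff_subset_sdiff_left Set.sdiff_subset).trans
        (Set.subset_union_right.trans (c.le_closure _))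
  have hgen : F ⊆ c (L ∪ (B \ T : Finset α)) := hFB.trans <| c.monotone <|
    Set.union_subset (hKL.trans Set.subset_union_left) fun x hx => by
      by_cases hxT : x ∈ T
      · exact Or.inl (hTL hxT)
      · exact Or.inr (Finset.mem_sdiff.2 ⟨hx, hxT⟩)
  rw [indepRank_eq_card hc hBF hB hFB, indepRank_eq_card hc hTL hT hLT, indepRank_eq_card hc
    ((Finset.coe_subset.2 Finset.sdiff_subset).trans hBF) hind hgen, ← Nat.cast_add,
    Finset.card_sdiff_add_card_eq_card hTB]

theorem indepRank_lt_aleph0_trans {K L F : Set α} (hLF : c.indepRank L F < Cardinal.aleph0)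
    (hKL : c.indepRank K L < Cardinal.aleph0) : c.indepRank K F < Cardinal.aleph0 := by
  classical
  obtain ⟨T, -, -, -, hLT⟩ := exists_basis_of_indepRank_lt hc (T := ∅) hKL
    (by simp) (by simp [IndepOver])
  obtain ⟨B, -, -, -, hFB⟩ := exists_basis_of_indepRank_lt hc (T := ∅) hLF
    (by simp) (by simp [IndepOver])
  refine (indepRank_le_card hc (B := T ∪ B) ?_).trans_lt Cardinal.natCast_lt_aleph0
  rw [Finset.coe_union, ← Set.union_assoc]
  exact hFB.trans (closure_le_of_subset (Set.union_subset
    (hLT.trans (c.monotone Set.subset_union_left)) (Set.subset_union_right.trans (c.le_closure _))))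

end ClosureOperator

section
variable {Ω : Type*} [NormedField Ω] [IsAlgClosed Ω]

/-- The closure operator sending `A` to the topological closure of the algebraic closure of the
field generated by `A`. -/
noncomputable def topAlgClosure (Ω : Type*) [NormedField Ω] [IsAlgClosed Ω] :
    ClosureOperator (Set Ω) :=
  .mk₂ (fun A => topAlgClosureOf A) subset_topAlgClosureOf fun _ _ h => topAlgClosureOf_le h

theorem hasExchange_topAlgClosure [CharZero Ω] [CompleteSpace Ω] [IsUltrametricDist Ω]
    (hres : ResidueCharZero Ω) : (topAlgClosure Ω).HasExchange :=
  fun _ _ _ => mem_topAlgClosureOf_exchange hres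

theorem isTopgebraicElem_hatGen_iff {K : Subfield Ω} {S : Set Ω} {x : Ω} :
    IsTopgebraicElem (hatGen K S) x ↔ x ∈ topAlgClosureOf ((K : Set Ω) ∪ S) := by
  constructor
  · refine fun h => closure_minimal (fun y hy => ?_) (isClosed_topAlgClosureOf _) h
    refine mem_topAlgClosureOf_of_isAlgebraic
      ((show IsAlgebraic (hatGen K S) y from hy).of_subfield_le ?_)
    exact Subfield.topologicalClosure_minimal _
      (Subfield.closure_le.2 (subset_topAlgClosureOf _)) (isClosed_topAlgClosureOf _)
  · refine fun h => closure_mono (fun y hy => ?_) h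
    exact (mem_algClosureOf.1 hy).of_subfield_le (Subfield.le_topologicalClosure _)

theorem topgebraicIndep_eq_indepOver (K : Subfield Ω) :
    TopgebraicIndep K = (topAlgClosure Ω).IndepOver K :=
  funext fun _ => propext <| forall₂_congr fun _ _ => not_congr isTopgebraicElem_hatGen_iff

theorem topdeg_eq_indepRank (K L : Subfield Ω) :
    topdeg K L = (topAlgClosure Ω).indepRank K L := by
  rw [topdeg, ClosureOperator.indepRank, topgebraicIndep_eq_indepOver]

end


end

/-- Theorem 4.3.3(ii): additivity of the topological transcendence degree
in towers `F/L/K` of analytic fields of residue characteristic zero, under finiteness. -/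
theorem residue_char_zero_topdeg_additive (K L F : Subfield Ω)
    (hKc : IsClosed (K : Set Ω)) (hLc : IsClosed (L : Set Ω)) (hFc : IsClosed (F : Set Ω))
    (hKL : K ≤ L) (hLF : L ≤ F)
    (hres : ResidueCharZero Ω)
    (hfin : topdeg K F < Cardinal.aleph0 ∨
      (topdeg L F < Cardinal.aleph0 ∧ topdeg K L < Cardinal.aleph0)) :
    topdeg K F = topdeg L F + topdeg K L := by
  have : CharZero Ω := charZero_of_inj_zero fun n hn => by
    by_contra h
    simpa [hn] using hres n h
  have hc := hasExchange_topAlgClosure hres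
  simp only [topdeg_eq_indepRank] at hfin ⊢
  refine ClosureOperator.indepRank_add_of_lt hc hKL hLF ?_
  exact hfin.elim id fun h => ClosureOperator.indepRank_lt_aleph0_trans hc h.1 h.2
end

section
/- Let k be an analytic field with a nontrivial absolute value, let a_0, a_1, a_2, ... be a (countable) sequence of elements of the separable closure k^s of k inside hat{k^a}, and let l = hat{k(a_0, a_1, ...)} be the completion of the separable algebraic extension k(a_0, a_1, ...) of k. Then the extension l/k is primitive: there exists t ∈ l with l = hat{k(t)}. -/
open Metric

set_option linter.unusedSectionVars false

/-!
Ambient setting: every extension of analytic (complete, non-archimedean, real-valued)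
fields `L/K` embeds isometrically into an algebraically closed, complete,
non-archimedean normed field `Ω` (e.g. the completed algebraic closure of `L`).
We therefore formalize analytic fields as closed subfields of such an ambient field `Ω`.
-/

variable {Ω : Type*} [NormedField Ω] [CompleteSpace Ω] [IsUltrametricDist Ω] [IsAlgClosed Ω]

/-- Conjugate integral elements over a complete non-archimedean field have the same norm. -/
lemma IsConjRoot.norm_eq {K L : Type*} [NontriviallyNormedField K] [CompleteSpace K]
    [IsUltrametricDist K] [NormedField L] [NormedAlgebra K L] {x y : L}
    (hx : IsIntegral K x) (h : IsConjRoot K x y) : ‖x‖ = ‖y‖ := by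
  have key (z : L) (hz : IsIntegral K z) : ‖z‖ = spectralValue (minpoly K z) := by
    let z' : algebraicClosure K L := ⟨z, mem_algebraicClosure_iff.mpr hz.isAlgebraic⟩
    rw [show minpoly K z = minpoly K z' from
      minpoly.algebraMap_eq (algebraMap (algebraicClosure K L) L).injective z']
    exact NormedAlgebra.norm_eq_spectralNorm K z'
  rw [key x hx, key y (h.isIntegral hx), h]

/-- Krasner's lemma for a closed subfield of an algebraically closed non-archimedean field. -/
lemma Subfield.mem_of_forall_isConjRoot_norm_lt {K : Subfield Ω} (hK : IsClosed (K : Set Ω))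
    (hnontriv : ∃ x : Ω, x ∈ K ∧ x ≠ 0 ∧ ‖x‖ ≠ 1) {x t : Ω} (hx : IsSeparable K x) (ht : t ∈ K)
    (h : ∀ x', IsConjRoot K x x' → x ≠ x' → ‖x - t‖ < ‖x - x'‖) : x ∈ K := by
  obtain ⟨c, hc, hc0, hc1⟩ := hnontriv
  let : NontriviallyNormedField K := NontriviallyNormedField.ofNormNeOne
    ⟨⟨c, hc⟩, fun e => hc0 (congrArg Subtype.val e), hc1⟩
  let : NormedAlgebra K Ω := ⟨fun r y => (norm_mul (r : Ω) y).le⟩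
  have : CompleteSpace K := hK.completeSpace_coe
  by_contra hxK
  have hbot : x ∉ (⊥ : Subalgebra K Ω) := by
    rintro ⟨y, rfl⟩
    exact hxK y.2
  obtain ⟨x', hne, hconj⟩ :=
    (notMem_iff_exists_ne_and_isConjRoot hx (IsAlgClosed.splits _)).mp hbot
  have hnorm : ‖x - t‖ = ‖x' - t‖ :=
    IsConjRoot.norm_eq (hx.isIntegral.sub (isIntegral_algebraMap (x := (⟨t, ht⟩ : K))))
      (hconj.sub_algebraMap ⟨t, ht⟩)
  have hle := dist_triangle_max x t x'
  rw [dist_comm t, dist_eq_norm, dist_eq_norm, dist_eq_norm, ← hnorm, max_self] at hle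
  exact (h x' hconj hne).not_ge hle

/-- A separable element lies in every closed extension field that comes close enough to it. -/
lemma IsSeparable.exists_krasner_radius {k : Subfield Ω}
    (hnontriv : ∃ x : Ω, x ∈ k ∧ x ≠ 0 ∧ ‖x‖ ≠ 1) {x : Ω} (hx : IsSeparable k x) :
    ∃ r > 0, ∀ K : Subfield Ω, k ≤ K → IsClosed (K : Set Ω) →
      ∀ t ∈ K, ‖x - t‖ < r → x ∈ K := by
  have hfin : ((minpoly k x).rootSet Ω \ {x}).Finite :=
    (Polynomial.rootSet_finite _ _).subset Set.sdiff_subset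
  obtain ⟨r, hr, hball⟩ := Metric.mem_nhds_iff.mp
    (hfin.isClosed.isOpen_compl.mem_nhds (show x ∈ _ from fun h => h.2 rfl))
  refine ⟨r, hr, fun K hkK hK t ht hxt => ?_⟩
  let : Algebra k K := (Subfield.inclusion hkK).toAlgebra
  have : IsScalarTower k K Ω := IsScalarTower.of_algebraMap_eq fun _ => rfl
  obtain ⟨c, hc, hc'⟩ := hnontriv
  refine Subfield.mem_of_forall_isConjRoot_norm_lt hK ⟨c, hkK hc, hc'⟩ (hx.tower_top K) ht
    fun x' hconj hne => hxt.trans_le ?_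
  by_contra! hlt
  refine hball (show x' ∈ ball x r by rwa [mem_ball, dist_comm, dist_eq_norm]) ⟨?_, hne.symm⟩
  exact (isConjRoot_iff_mem_minpoly_rootSet hx.isIntegral).mp
    (IsConjRoot.of_isScalarTower (L := K) hx.isIntegral hconj)

lemma Subfield.exists_ne_zero_norm_mul_lt {k : Subfield Ω}
    (hnontriv : ∃ x : Ω, x ∈ k ∧ x ≠ 0 ∧ ‖x‖ ≠ 1) (y : Ω) {ε : ℝ} (hε : 0 < ε) :
    ∃ c ∈ k, c ≠ 0 ∧ ‖c * y‖ < ε := by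
  obtain ⟨b, hb, hb0, hb1⟩ := hnontriv
  let : NontriviallyNormedField k := NontriviallyNormedField.ofNormNeOne
    ⟨⟨b, hb⟩, fun e => hb0 (congrArg Subtype.val e), hb1⟩
  obtain ⟨c, hc0, hc⟩ := NormedField.exists_norm_lt k (r := ε / (‖y‖ + 1)) (by positivity)
  refine ⟨c, c.2, norm_pos_iff.mp hc0, ?_⟩
  have hc' : ‖(c : Ω)‖ < ε / (‖y‖ + 1) := hc
  rw [lt_div_iff₀ (by positivity)] at hc'
  rw [norm_mul]
  exact lt_of_le_of_lt (by gcongr; linarith) hc'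

lemma isClosed_hatGen (K : Subfield Ω) (S : Set Ω) : IsClosed (hatGen K S : Set Ω) :=
  Subfield.isClosed_topologicalClosure _

lemma hatGen_le {K M : Subfield Ω} {S : Set Ω} (hM : IsClosed (M : Set Ω)) (hKM : K ≤ M)
    (hSM : S ⊆ M) : hatGen K S ≤ M :=
  Subfield.topologicalClosure_minimal _ (Subfield.closure_le.mpr (Set.union_subset hKM hSM)) hM

/-- Steps bounded by at least halving radii converge, within the `n`-th radius of the
`n`-th term. -/
lemma exists_tendsto_norm_sub_le {u : ℕ → Ω} {ρ : ℕ → ℝ} (hpos : ∀ n, 0 < ρ n)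
    (hρ : ∀ n, ρ (n + 1) ≤ ρ n / 2) (hu : ∀ n, ‖u (n + 1) - u n‖ ≤ ρ n) :
    ∃ t, Filter.Tendsto u Filter.atTop (nhds t) ∧ ∀ n, ‖u n - t‖ ≤ ρ n := by
  have hanti : Antitone ρ := antitone_nat_of_succ_le fun n => by linarith [hρ n, hpos n]
  have hgeom (n : ℕ) : ρ n ≤ ρ 0 * (1 / 2) ^ n := by
    induction n with
    | zero => simp
    | succ n ih => rw [pow_succ]; linarith [hρ n]
  have hcauchy : CauchySeq u := cauchySeq_of_le_geometric (1 / 2) (ρ 0) (by norm_num) fun n => by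
    rw [dist_comm, dist_eq_norm]
    exact (hu n).trans (hgeom n)
  obtain ⟨t, ht⟩ := cauchySeq_tendsto_of_complete hcauchy
  refine ⟨t, ht, fun n => ?_⟩
  have hdist (m : ℕ) (hm : n ≤ m) : ‖u n - u m‖ ≤ ρ n := by
    induction m, hm using Nat.le_induction with
    | base => simpa using (hpos n).le
    | succ m hm ih =>
      have h := dist_triangle_max (u n) (u m) (u (m + 1))
      rw [dist_comm (u m), dist_eq_norm, dist_eq_norm, dist_eq_norm] at h
      exact h.trans (max_le ih ((hu m).trans (hanti hm)))
  exact le_of_tendsto (tendsto_const_nhds.sub ht).norm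
    (Filter.eventually_atTop.mpr ⟨n, hdist⟩)

/-- Theorem 5.1.2: if `k` is an analytic field with nontrivial absolute
value and `l = hat{k(a₀,a₁,…)}` is the completion of a countably generated separable
algebraic extension of `k`, then `l/k` is primitive: `l = hat{k(t)}` for some `t ∈ l`. -/
theorem countably_generated_separable_is_primitive (k : Subfield Ω)
    (hkc : IsClosed (k : Set Ω))
    (hnontriv : ∃ x : Ω, x ∈ k ∧ x ≠ 0 ∧ ‖x‖ ≠ 1)
    (a : ℕ → Ω) (halg : ∀ n, IsAlgebraic k (a n)) (hsep : ∀ n, IsSeparable k (a n)) :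
    ∃ t ∈ hatGen k (Set.range a), hatGen k ({t} : Set Ω) = hatGen k (Set.range a) := by
  have hrad (x : Ω) : ∃ r > 0, IsSeparable k x → ∀ K : Subfield Ω, k ≤ K →
      IsClosed (K : Set Ω) → ∀ t ∈ K, ‖x - t‖ < r → x ∈ K := by
    by_cases hx : IsSeparable k x
    · obtain ⟨r, hr, h⟩ := hx.exists_krasner_radius hnontriv
      exact ⟨r, hr, fun _ => h⟩
    · exact ⟨1, one_pos, fun h => absurd h hx⟩
  choose r hr hkrasner using hrad
  choose c hck hc0 hc using
    fun (y : Ω) (ε : {ε : ℝ // 0 < ε}) => Subfield.exists_ne_zero_norm_mul_lt hnontriv y ε.2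
  let s : ℕ → Ω × {ε : ℝ // 0 < ε} := Nat.rec (0, ⟨r 0 / 2, half_pos (hr 0)⟩) fun n p =>
    let x := p.1 + c (a n) p.2 * a n
    (x, ⟨min (p.2 / 2) (r x / 2), lt_min (half_pos p.2.2) (half_pos (hr x))⟩)
  let u (n : ℕ) : Ω := (s n).1
  let ρ (n : ℕ) : ℝ := (s n).2
  have hu (n : ℕ) : u (n + 1) = u n + c (a n) (s n).2 * a n := rfl
  have hρr (n : ℕ) : ρ n < r (u n) := by
    refine lt_of_le_of_lt ?_ (half_lt_self (hr (u n)))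
    cases n with
    | zero => exact le_rfl
    | succ n => exact min_le_right _ _
  have husep (n : ℕ) : IsSeparable k (u n) := by
    induction n with
    | zero => exact isSeparable_algebraMap (0 : k)
    | succ n ih =>
      rw [hu]
      exact Field.isSeparable_add ih
        (Field.isSeparable_mul (isSeparable_algebraMap (⟨_, hck _ _⟩ : k)) (hsep n))
  have humem (n : ℕ) : u n ∈ hatGen k (Set.range a) := by
    induction n with
    | zero => exact zero_mem _
    | succ n ih =>
      rw [hu]
      exact add_mem ih (mul_mem (mem_hatGen_of_mem (hck _ _)) (mem_hatGen_of_mem_set ⟨n, rfl⟩))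
  obtain ⟨t, ht, hut⟩ := exists_tendsto_norm_sub_le (u := u) (ρ := ρ) (fun n => (s n).2.2)
    (fun n => min_le_left _ _) fun n => by
      rw [hu, add_sub_cancel_left]
      exact (hc (a n) (s n).2).le
  have htmem : t ∈ hatGen k (Set.range a) :=
    (isClosed_hatGen k _).mem_of_tendsto ht (Filter.Eventually.of_forall humem)
  refine ⟨t, htmem, le_antisymm ?_ ?_⟩
  · exact hatGen_le (isClosed_hatGen _ _) (fun _ => mem_hatGen_of_mem)
      (Set.singleton_subset_iff.mpr htmem)
  · refine hatGen_le (isClosed_hatGen _ _) (fun _ => mem_hatGen_of_mem) ?_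
    rintro _ ⟨n, rfl⟩
    have hmem (n : ℕ) : u n ∈ hatGen k {t} :=
      hkrasner (u n) (husep n) _ (fun _ => mem_hatGen_of_mem) (isClosed_hatGen _ _) t
        (mem_hatGen_of_mem_set rfl) ((hut n).trans_lt (hρr n))
    have hca : c (a n) (s n).2 * a n ∈ hatGen k {t} := by
      simpa [hu] using sub_mem (hmem (n + 1)) (hmem n)
    have hquot := mul_mem (inv_mem (mem_hatGen_of_mem (S := {t}) (hck (a n) (s n).2))) hca
    rwa [inv_mul_cancel_left₀ (hc0 _ _)] at hquot
end

section
/- Assume that K/k is an extension of analytic fields with topdeg(K/k) ≤ 1. Then the set S_{K/k} of all subfields of K of the form hat{k(t)^a} — that is, closed subfields L ⊆ K containing k that are algebraically closed and such that for some t ∈ L the algebraic closure of k(t) inside L is dense in L — is totally ordered with respect to inclusion. -/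
open Metric

set_option linter.unusedSectionVars false

/-!
Ambient setting: every extension of analytic (complete, non-archimedean, real-valued)
fields `L/K` embeds isometrically into an algebraically closed, complete,
non-archimedean normed field `Ω` (e.g. the completed algebraic closure of `L`).
We therefore formalize analytic fields as closed subfields of such an ambient field `Ω`.
-/

variable {Ω : Type*} [NormedField Ω] [CompleteSpace Ω] [IsUltrametricDist Ω] [IsAlgClosed Ω]

open Polynomial in
/-- An algebraically closed subfield of `Ω` contains every element of `Ω` that is algebraic
over one of its subfields. -/
lemma mem_of_isAlgebraic_of_isAlgClosed {F : Type*} [Field F] {M L : Subfield F} (hML : M ≤ L)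
    [IsAlgClosed L] {x : F} (hx : IsAlgebraic M x) : x ∈ L := by
  obtain ⟨p, hp, hpx⟩ := hx
  have hx' : IsAlgebraic L x := by
    refine ⟨p.map (Subfield.inclusion hML),
      (Polynomial.map_ne_zero_iff (Subfield.inclusion hML).injective).2 hp, ?_⟩
    rw [aeval_def, eval₂_map]
    exact hpx
  obtain ⟨y, rfl⟩ := minpoly.mem_range_of_degree_eq_one L x
    (IsAlgClosed.degree_eq_one_of_irreducible L (minpoly.irreducible hx'.isIntegral))
  exact y.2

/-- A closed, algebraically closed subfield `L` containing `k` and `s` contains every element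
topgebraic over `hatGen k {s}`. -/
lemma mem_of_isTopgebraicElem_hatGen {k L : Subfield Ω} (hk : k ≤ L)
    (hL : IsClosed (L : Set Ω)) [IsAlgClosed L] {s t : Ω} (hs : s ∈ L)
    (ht : IsTopgebraicElem (hatGen k {s}) t) : t ∈ L := by
  have hle : hatGen k {s} ≤ L :=
    Subfield.topologicalClosure_minimal _
      (Subfield.closure_le.2 (Set.union_subset hk (Set.singleton_subset_iff.2 hs))) hL
  exact closure_minimal (fun _ hx => mem_of_isAlgebraic_of_isAlgClosed hle hx) hL ht

/-- If the elements of `L₁` algebraic over `k(t)` are dense in `L₁`, then every closed,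
algebraically closed subfield containing `k` and `t` contains `L₁`. -/
lemma le_of_subset_closure_isAlgebraic {k L₁ L₂ : Subfield Ω} (hk : k ≤ L₂)
    (hL₂ : IsClosed (L₂ : Set Ω)) [IsAlgClosed L₂] {t : Ω} (ht : t ∈ L₂)
    (hdense : (L₁ : Set Ω) ⊆
      closure {x : Ω | x ∈ L₁ ∧ IsAlgebraic (Subfield.closure ((k : Set Ω) ∪ {t})) x}) :
    L₁ ≤ L₂ := by
  have hle : Subfield.closure ((k : Set Ω) ∪ {t}) ≤ L₂ :=
    Subfield.closure_le.2 (Set.union_subset hk (Set.singleton_subset_iff.2 ht))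
  exact hdense.trans
    (closure_minimal (fun _ hx => mem_of_isAlgebraic_of_isAlgClosed hle hx.2) hL₂)

/-- The cardinality of a topgebraically independent subset of `L` is at most `topdeg K L`. -/
lemma TopgebraicIndep.mk_le_topdeg {K L : Subfield Ω} {S : Set Ω} (hS : TopgebraicIndep K S)
    (hSL : S ⊆ (L : Set Ω)) : Cardinal.mk S ≤ topdeg K L :=
  le_ciSup (f := fun S : {S : Set Ω // S ⊆ (L : Set Ω) ∧ TopgebraicIndep K S} =>
    Cardinal.mk S.1) Cardinal.bddAbove_of_small ⟨S, hSL, hS⟩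

/-- If `topdeg K L ≤ 1`, then of two distinct elements of `L` one is topgebraic over the
completed extension of `K` generated by the other. -/
lemma isTopgebraicElem_or_of_topdeg_le_one {K L : Subfield Ω} (hdeg : topdeg K L ≤ 1) {s t : Ω}
    (hs : s ∈ L) (ht : t ∈ L) (hst : s ≠ t) :
    IsTopgebraicElem (hatGen K {t}) s ∨ IsTopgebraicElem (hatGen K {s}) t := by
  by_contra! h
  have hS : TopgebraicIndep K {s, t} := by
    rintro x (rfl | rfl)
    · rw [Set.pair_sdiff_left hst]
      exact h.1
    · rw [Set.pair_sdiff_right hst]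
      exact h.2
  have hcard := (hS.mk_le_topdeg (Set.pair_subset hs ht)).trans hdeg
  exact hst (Set.mem_singleton_iff.1
    (Cardinal.mk_le_one_iff_set_subsingleton.1 hcard (Set.mem_insert s _)
      (Set.mem_insert_of_mem s rfl)))

/-- Theorem 5.3.6: if `topdeg(K/k) ≤ 1`, then the set of all subfields
of `K` of the form `hat{k(t)^a}` — closed algebraically closed subfields `k ≤ L ≤ K` in
which the algebraic closure of some `k(t)` inside `L` is dense — is totally ordered by
inclusion. -/
theorem subfields_totally_ordered (k K : Subfield Ω)
    (hkc : IsClosed (k : Set Ω)) (hKc : IsClosed (K : Set Ω)) (hkK : k ≤ K)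
    (hdeg : topdeg k K ≤ 1) :
    ∀ L₁ L₂ : Subfield Ω,
      (k ≤ L₁ ∧ L₁ ≤ K ∧ IsClosed (L₁ : Set Ω) ∧ IsAlgClosed L₁ ∧
        ∃ t ∈ L₁, (L₁ : Set Ω) ⊆
          closure {x : Ω | x ∈ L₁ ∧ IsAlgebraic (Subfield.closure ((k : Set Ω) ∪ {t})) x}) →
      (k ≤ L₂ ∧ L₂ ≤ K ∧ IsClosed (L₂ : Set Ω) ∧ IsAlgClosed L₂ ∧
        ∃ t ∈ L₂, (L₂ : Set Ω) ⊆
          closure {x : Ω | x ∈ L₂ ∧ IsAlgebraic (Subfield.closure ((k : Set Ω) ∪ {t})) x}) →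
      L₁ ≤ L₂ ∨ L₂ ≤ L₁ := by
  rintro L₁ L₂ ⟨hk₁, hK₁, hc₁, _, t₁, ht₁, hd₁⟩ ⟨hk₂, hK₂, hc₂, _, t₂, ht₂, hd₂⟩
  obtain rfl | hne := eq_or_ne t₁ t₂
  · exact Or.inl (le_of_subset_closure_isAlgebraic hk₂ hc₂ ht₂ hd₁)
  · refine (isTopgebraicElem_or_of_topdeg_le_one hdeg (hK₁ ht₁) (hK₂ ht₂) hne).imp
      (fun h => ?_) (fun h => ?_)
    · exact le_of_subset_closure_isAlgebraic hk₂ hc₂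
        (mem_of_isTopgebraicElem_hatGen hk₂ hc₂ ht₂ h) hd₁
    · exact le_of_subset_closure_isAlgebraic hk₁ hc₁
        (mem_of_isTopgebraicElem_hatGen hk₁ hc₁ ht₁ h) hd₂
end

section
/- Assume that K/k is an extension of analytic fields with topdeg(K/k) = 1. Let κ be the cardinality of k and ω = max(κ, 2^ℵ0). Then the cardinality of K does not exceed 2^ω. -/
open Metric

set_option linter.unusedSectionVars false

/-!
Ambient setting: every extension of analytic (complete, non-archimedean, real-valued)
fields `L/K` embeds isometrically into an algebraically closed, complete,
non-archimedean normed field `Ω` (e.g. the completed algebraic closure of `L`).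
We therefore formalize analytic fields as closed subfields of such an ambient field `Ω`.
-/

variable {Ω : Type*} [NormedField Ω] [CompleteSpace Ω] [IsUltrametricDist Ω] [IsAlgClosed Ω]

theorem pow_card_le_norm_prod_map_sub (x : Ω) {ε : ℝ} (hε : 0 ≤ ε) (s : Multiset Ω)
    (hs : ∀ b ∈ s, ε ≤ ‖x - b‖) : ε ^ s.card ≤ ‖(s.map (x - ·)).prod‖ := by
  induction s using Multiset.induction with
  | empty => simp
  | cons a s ih =>
    simp only [Multiset.map_cons, Multiset.prod_cons, Multiset.card_cons, norm_mul, pow_succ']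
    exact mul_le_mul (hs a (by simp)) (ih fun b hb => hs b (by simp [hb]))
      (by positivity) (norm_nonneg _)

open Polynomial in
/-- Elements algebraic over the topological closure of a subfield are limits of elements algebraic
over the subfield itself. -/
theorem mem_closure_isAlgebraic_of_isAlgebraic_topologicalClosure (F : Subfield Ω) {x : Ω}
    (hx : IsAlgebraic F.topologicalClosure x) : x ∈ closure {y : Ω | IsAlgebraic F y} := by
  rw [Metric.mem_closure_iff]
  intro ε hε
  set p := minpoly F.topologicalClosure x with hp
  have hmon : p.Monic := minpoly.monic hx.isIntegral
  set n := p.natDegree with hn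
  let g : (Fin n → Ω) → Ω := fun c => x ^ n + ∑ i, c i * x ^ (i : ℕ)
  have hg : Continuous g := by fun_prop
  let c₀ : Fin n → Ω := fun i => (p.coeff i : Ω)
  have hg₀ : g c₀ = 0 := by
    have h := minpoly.aeval F.topologicalClosure x
    rw [← hp, aeval_eq_sum_range, Finset.sum_range_succ, ← hn, hmon.coeff_natDegree,
      Finset.sum_range] at h
    simp only [Subfield.smul_def, smul_eq_mul, one_smul] at h
    rw [add_comm] at h
    exact h
  have hc₀ : c₀ ∈ closure (Set.univ.pi fun _ : Fin n => (F : Set Ω)) := by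
    rw [closure_pi_set]
    exact fun i _ => (p.coeff i).2
  obtain ⟨c, hc, hcF⟩ := mem_closure_iff.1 hc₀ (g ⁻¹' Metric.ball 0 (ε ^ n))
    (Metric.isOpen_ball.preimage hg) (by simp [hg₀, pow_pos hε])
  let r : F[X] := ∑ i : Fin n, C ⟨c i, hcF i trivial⟩ * X ^ (i : ℕ)
  have hr : r.degree < n := by
    refine (degree_sum_le _ _).trans_lt ((Finset.sup_lt_iff (WithBot.bot_lt_coe n)).2 fun i _ => ?_)
    exact (degree_C_mul_X_pow_le _ _).trans_lt (WithBot.coe_lt_coe.2 i.2)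
  have hq : (X ^ n + r).Monic := monic_X_pow_add hr
  have hqdeg : (X ^ n + r).natDegree = n := natDegree_eq_of_degree_eq_some (by
    rw [degree_add_eq_left_of_degree_lt (by simpa using hr), degree_X_pow])
  have hqx : aeval x (X ^ n + r) = g c := by
    simp [r, g, map_sum, Algebra.algebraMap_eq_smul_one, Subfield.smul_def]
  have hsplit : (((X ^ n + r).map (algebraMap F Ω))).Splits := IsAlgClosed.splits _
  rw [hsplit.aeval_eq_prod_aroots_of_monic hq] at hqx
  have hcard : Multiset.card ((X ^ n + r).aroots Ω) = n := by
    rw [aroots, ← hsplit.natDegree_eq_card_roots, natDegree_map, hqdeg]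
  by_contra! hfar
  have hfar' : ∀ b ∈ (X ^ n + r).aroots Ω, ε ≤ ‖x - b‖ := fun b hb => by
    rw [← dist_eq_norm]
    exact hfar b ⟨_, hq.ne_zero, (mem_aroots.1 hb).2⟩
  have hlt : ‖g c‖ < ε ^ n := by simpa using hc
  refine hlt.not_ge ?_
  have hprod := pow_card_le_norm_prod_map_sub x hε.le _ hfar'
  rwa [hcard, hqx] at hprod

open Cardinal in
theorem Cardinal.mk_closure_le_power_aleph0 {X : Type*} [MetricSpace X] (D : Set X) :
    #(closure D) ≤ #D ^ ℵ₀ := by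
  have h : ∀ x : closure D, ∃ u : ℕ → D, Filter.Tendsto (fun n => (u n : X)) .atTop (nhds x) := by
    intro x
    obtain ⟨u, hu, hlim⟩ := mem_closure_iff_seq_limit.1 x.2
    exact ⟨fun n => ⟨u n, hu n⟩, hlim⟩
  choose u hu using h
  have hinj : Function.Injective u := fun x y hxy =>
    Subtype.ext (tendsto_nhds_unique (hu x) (hxy ▸ hu y))
  simpa using mk_le_of_injective hinj

open Cardinal in
/-- If a set in a metric space is totally preordered in a weak sense by a relation whose lower sets
are closures of sets of cardinality at most `ω`, then its cardinality is at most `2 ^ ω`. -/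
theorem Cardinal.mk_le_two_power_of_total_of_closure {X : Type*} [MetricSpace X] (K : Set X)
    (D : X → Set X) {ω : Cardinal} (hω : ℵ₀ ≤ ω) (hD : ∀ y ∈ K, #(D y) ≤ ω)
    (htot : ∀ x ∈ K, ∀ y ∈ K, x ∈ closure (D y) ∨ y ∈ closure (D x)) :
    #K ≤ 2 ^ ω := by
  by_contra! hK
  have hcl : ∀ y ∈ K, #(closure (D y)) ≤ 2 ^ ω := fun y hy =>
    calc #(closure (D y)) ≤ #(D y) ^ ℵ₀ := mk_closure_le_power_aleph0 _
      _ ≤ ω ^ ω := (power_le_power_right (hD y hy)).trans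
        (power_le_power_left (aleph0_pos.trans_le hω).ne' hω)
      _ = 2 ^ ω := power_self_eq hω
  have hbound : ∀ A : Set K, #A ≤ 2 ^ ω → ∃ x : K, ∀ a ∈ A, (x : X) ∉ closure (D a) := by
    intro A hA
    by_contra! hcov
    have hsub : K ⊆ ⋃ a : A, closure (D a) := fun x hx => by
      obtain ⟨a, ha, hxa⟩ := hcov ⟨x, hx⟩
      exact Set.mem_iUnion.2 ⟨⟨a, ha⟩, hxa⟩
    refine hK.not_ge ?_
    calc #K ≤ #(⋃ a : A, closure (D a)) := mk_le_mk_of_subset hsub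
      _ ≤ #A * ⨆ a : A, #(closure (D a)) := mk_iUnion_le _
      _ ≤ 2 ^ ω * 2 ^ ω := mul_le_mul' hA (ciSup_le' fun a => hcl _ a.1.2)
      _ = 2 ^ ω := mul_eq_self (hω.trans (cantor ω).le)
  have hne : Nonempty K := by
    rw [← mk_ne_zero_iff]
    exact (bot_le.trans_lt hK).ne'
  have hbound' : ∀ A : Set K, ∃ x : K, #A ≤ 2 ^ ω → ∀ a ∈ A, (x : X) ∉ closure (D a) := by
    intro A
    by_cases hA : #A ≤ 2 ^ ω
    · obtain ⟨x, hx⟩ := hbound A hA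
      exact ⟨x, fun _ => hx⟩
    · exact ⟨hne.some, fun h => absurd h hA⟩
  choose g hg using hbound'
  let T := (Order.succ ω).ord.ToType
  have hT : #T = Order.succ ω := mk_ord_toType _
  have hTle : #T ≤ 2 ^ ω := hT ▸ Order.succ_le_of_lt (cantor ω)
  have : NoMaxOrder T := noMaxOrder (hω.trans (Order.le_succ ω))
  let f : T → K := (wellFounded_lt (α := T)).fix fun a F => g (Set.range fun b : Set.Iio a => F b b.2)
  have hf : ∀ a b : T, b < a → (f a : X) ∉ closure (D (f b)) := by
    intro a b hba
    have heq : f a = g (Set.range fun b : Set.Iio a => f b) :=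
      (wellFounded_lt (α := T)).fix_eq _ a
    rw [heq]
    exact hg _ (mk_range_le.trans ((mk_set_le _).trans hTle)) _ ⟨⟨b, hba⟩, rfl⟩
  obtain ⟨y, hy⟩ := hbound (Set.range f) (mk_range_le.trans hTle)
  have hfy : ∀ a, (f a : X) ∈ closure (D y) := fun a =>
    (htot _ (f a).2 _ y.2).resolve_right (hy _ ⟨a, rfl⟩)
  have hball : ∀ a : T, ∃ z : D y × ℕ, ∃ b : T, a < b ∧ (∀ c, a < c → b ≤ c) ∧
      dist (f b : X) z.1 < 1 / (z.2 + 1) ∧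
      ∀ w ∈ closure (D (f a)), ¬ dist w z.1 < 1 / (z.2 + 1 : ℝ) := by
    intro a
    have hmin : ∃ b : T, a < b ∧ ∀ c, a < c → b ≤ c :=
      ⟨(wellFounded_lt (α := T)).min (Set.Ioi a) (exists_gt a),
        (wellFounded_lt (α := T)).min_mem (Set.Ioi a) _,
        fun c hc => not_lt.1 ((wellFounded_lt (α := T)).not_lt_min (Set.Ioi a) hc)⟩
    obtain ⟨b, hab, hb⟩ := hmin
    obtain ⟨ε, hε, hεball⟩ := Metric.isOpen_iff.1
      (isClosed_closure (s := D (f a))).isOpen_compl _ (hf b a hab)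
    obtain ⟨n, hn⟩ := exists_nat_one_div_lt (half_pos hε)
    obtain ⟨d, hd, hdist⟩ := Metric.mem_closure_iff.1 (hfy b) (1 / (n + 1 : ℝ)) (by positivity)
    refine ⟨(⟨d, hd⟩, n), b, hab, hb, hdist, fun w hw hwd => hεball (Metric.mem_ball.2 ?_) hw⟩
    have := dist_triangle_right w (f b : X) d
    dsimp only at hwd
    linarith
  choose z s hs hsmin hsz hz using hball
  have hne_of_lt : ∀ a b : T, a < b → z a ≠ z b := by
    intro a b hab heq
    have hmem : (f (s a) : X) ∈ closure (D (f b)) := by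
      rcases (hsmin a b hab).lt_or_eq with h | h
      · exact (htot _ (f (s a)).2 _ (f b).2).resolve_right (hf _ _ h)
      · rw [h]
        exact (htot _ (f b).2 _ (f b).2).elim id id
    exact hz b _ hmem (heq ▸ hsz a)
  have hinj : Function.Injective z := fun a b hab => by
    by_contra hne
    rcases lt_or_gt_of_ne hne with h | h
    · exact hne_of_lt a b h hab
    · exact hne_of_lt b a h hab.symm
  refine (Order.lt_succ ω).not_ge ?_
  calc Order.succ ω = #T := hT.symm
    _ ≤ #(D y × ℕ) := mk_le_of_injective hinj
    _ = #(D y) * ℵ₀ := by simp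
    _ ≤ ω * ω := mul_le_mul' (hD y y.2) hω
    _ = ω := mul_eq_self hω

theorem isTopgebraicElem_hatGen_self (k : Subfield Ω) (S : Set Ω) {x : Ω} (hx : x ∈ S) :
    IsTopgebraicElem (hatGen k S) x :=
  subset_closure (isAlgebraic_algebraMap (⟨x, mem_hatGen_of_mem_set hx⟩ : hatGen k S))

/-- In an extension of topological transcendence degree at most one, any two elements are comparable
with respect to topgebraic dependence. -/
theorem isTopgebraicElem_or_of_topdeg_le_one_s18 {k K : Subfield Ω} (hdeg : topdeg k K ≤ 1) {x y : Ω}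
    (hx : x ∈ K) (hy : y ∈ K) :
    IsTopgebraicElem (hatGen k {y}) x ∨ IsTopgebraicElem (hatGen k {x}) y := by
  by_contra! h
  obtain ⟨hxy, hyx⟩ := h
  have hne : x ≠ y := by
    rintro rfl
    exact hxy (isTopgebraicElem_hatGen_self k _ rfl)
  have hS : ({x, y} : Set Ω) ⊆ K ∧ TopgebraicIndep k {x, y} := by
    refine ⟨Set.insert_subset hx (Set.singleton_subset_iff.2 hy), ?_⟩
    rintro z (rfl | rfl)
    · rwa [Set.insert_sdiff_of_mem _ (Set.mem_singleton z),
        Set.sdiff_singleton_eq_self (by simpa using hne)]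
    · rw [Set.pair_comm, Set.insert_sdiff_of_mem _ (Set.mem_singleton z),
        Set.sdiff_singleton_eq_self (by simpa using hne.symm)]
      exact hyx
  have hle : Cardinal.mk ({x, y} : Set Ω) ≤ 1 :=
    (le_ciSup (Cardinal.bddAbove_of_small (s := Set.range
      fun S : {S : Set Ω // S ⊆ (K : Set Ω) ∧ TopgebraicIndep k S} => Cardinal.mk S.1))
      ⟨_, hS⟩).trans hdeg
  have := Cardinal.mk_le_one_iff_set_subsingleton.1 hle
  exact hne (this (by simp) (by simp))

/-- The topgebraic elements over `hatGen k S` are limits of elements algebraic over the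
(uncompleted) subfield generated by `k` and `S`. -/
theorem closure_isAlgebraic_hatGen (k : Subfield Ω) (S : Set Ω) :
    closure {x : Ω | IsAlgebraic (hatGen k S) x} ⊆
      closure {x : Ω | IsAlgebraic (Subfield.closure ((k : Set Ω) ∪ S)) x} :=
  closure_minimal
    (fun _ hx => mem_closure_isAlgebraic_of_isAlgebraic_topologicalClosure _ hx) isClosed_closure

/-- Corollary 5.3.8: if `topdeg(K/k) = 1`, `κ = |k|` and
`ω = max(κ, 2^ℵ₀)`, then `|K| ≤ 2^ω`. -/
theorem card_le_of_topdeg_one (k K : Subfield Ω)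
    (hkc : IsClosed (k : Set Ω)) (hKc : IsClosed (K : Set Ω)) (hkK : k ≤ K)
    (hdeg : topdeg k K = 1) :
    Cardinal.mk K ≤ 2 ^ max (Cardinal.mk k) (2 ^ Cardinal.aleph0) := by
  have hω : Cardinal.aleph0 ≤ max (Cardinal.mk k) (2 ^ Cardinal.aleph0) :=
    (Cardinal.cantor _).le.trans (le_max_right _ _)
  refine Cardinal.mk_le_two_power_of_total_of_closure (K : Set Ω)
    (fun y => {x : Ω | IsAlgebraic (Subfield.closure ((k : Set Ω) ∪ {y})) x}) hω ?_ ?_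
  · intro y _
    refine (Algebraic.cardinalMk_le_max _ _).trans (max_le ?_ hω)
    refine (Subfield.cardinalMk_closure_le_max _).trans (max_le ?_ hω)
    refine (Cardinal.mk_union_le _ _).trans (Cardinal.add_le_of_le hω (le_max_left _ _) ?_)
    rw [Cardinal.mk_singleton]
    exact Cardinal.one_le_aleph0.trans hω
  · intro x hx y hy
    exact (isTopgebraicElem_or_of_topdeg_le_one_s18 hdeg.le hx hy).imp
      (fun h => closure_isAlgebraic_hatGen _ _ h) (fun h => closure_isAlgebraic_hatGen _ _ h)
end
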